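/- Let R be a ℤ-graded Noetherian universally catenary domain. The following are equivalent: (a) R is a graded perinormal domain; (b) R is a gr-(R₁) domain and for each homogeneous prime 𝔭 of R, the homogeneous localization R_(𝔭) is the only graded ring S between R_(𝔭) and the graded quotient field R_H such that the induced contraction map h-Spec(S) → h-Spec(R_(𝔭)) is an order-reflecting bijection; (c) R is a gr-(R₁) domain and for each homogeneous prime 𝔭 of R, R_(𝔭) is the only graded ring S between R_(𝔭) and the integral closure of R_(𝔭) such that the induced map h-Spec(S) → h-Spec(R_(𝔭)) is an order-reflecting bijection. -/

import Mathlib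

/-! Core definitions for graded perinormality, following Epstein–Shapiro style graded notions. -/

section Core

variable {ι : Type*} [DecidableEq ι] [AddCommMonoid ι]
variable {R : Type*} [CommRing R]

/-- `𝒜` is a grading of the ring `R` by the (torsionless) monoid `ι`:
the components multiply correctly and give an internal direct sum decomposition. -/
structure IsGrRing (𝒜 : ι → AddSubgroup R) : Prop where
  one_mem : (1 : R) ∈ 𝒜 0
  mul_mem : ∀ {i j : ι} {a b : R}, a ∈ 𝒜 i → b ∈ 𝒜 j → a * b ∈ 𝒜 (i + j)
  internal : DirectSum.IsInternal 𝒜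

/-- An ideal of `R` is homogeneous iff every element of it is a finite sum of
homogeneous elements of the ideal. -/
def IsHomIdeal (𝒜 : ι → AddSubgroup R) (I : Ideal R) : Prop :=
  ∀ x ∈ I, x ∈ AddSubmonoid.closure {y : R | SetLike.IsHomogeneousElem 𝒜 y ∧ y ∈ I}

/-- A graded (homogeneous) maximal ideal: maximal among proper homogeneous ideals. -/
def IsGrMaxIdeal (𝒜 : ι → AddSubgroup R) (I : Ideal R) : Prop :=
  IsHomIdeal 𝒜 I ∧ I ≠ ⊤ ∧ ∀ J : Ideal R, IsHomIdeal 𝒜 J → I ≤ J → J ≠ ⊤ → J = I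

/-- `R` is gr-local: it has exactly one graded maximal ideal. -/
def GrLocal (𝒜 : ι → AddSubgroup R) : Prop :=
  ∃! I : Ideal R, IsGrMaxIdeal 𝒜 I

/-- A prime ideal of height one (in a domain). -/
def HeightOnePrime (P : Ideal R) : Prop :=
  P.IsPrime ∧ P ≠ ⊥ ∧ ∀ Q : Ideal R, Q.IsPrime → Q < P → Q = ⊥

variable [IsDomain R]

/-- A homogeneous element of the graded quotient field of `R`, i.e. a quotient of two
homogeneous elements of `R` (viewed inside the full quotient field). -/
def IsHomFrac (𝒜 : ι → AddSubgroup R) (x : FractionRing R) : Prop :=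
  ∃ (i j : ι) (a b : R), a ∈ 𝒜 i ∧ b ∈ 𝒜 j ∧ b ≠ 0 ∧
    x * algebraMap R (FractionRing R) b = algebraMap R (FractionRing R) a

/-- `S` is a graded overring of `R`: a ring between `R` and the graded quotient field that is
the sum of its homogeneous components, i.e. each of its elements is a finite sum of
homogeneous elements of `S`. -/
def IsGradedOverring (𝒜 : ι → AddSubgroup R) (S : Subalgebra R (FractionRing R)) : Prop :=
  ∀ x ∈ S, x ∈ AddSubmonoid.closure {y : FractionRing R | y ∈ S ∧ IsHomFrac 𝒜 y}

/-- A homogeneous ideal of an overring `S` of `R`. -/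
def IsHomIdealOver (𝒜 : ι → AddSubgroup R) (S : Subalgebra R (FractionRing R))
    (I : Ideal S) : Prop :=
  ∀ x ∈ I, (x : FractionRing R) ∈ AddSubmonoid.closure
    {y : FractionRing R | IsHomFrac 𝒜 y ∧ ∃ h : y ∈ S, (⟨y, h⟩ : S) ∈ I}

/-- A graded maximal ideal of an overring. -/
def IsGrMaxIdealOver (𝒜 : ι → AddSubgroup R) (S : Subalgebra R (FractionRing R))
    (I : Ideal S) : Prop :=
  IsHomIdealOver 𝒜 S I ∧ I ≠ ⊤ ∧
    ∀ J : Ideal S, IsHomIdealOver 𝒜 S J → I ≤ J → J ≠ ⊤ → J = I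

/-- The overring `S` is gr-local. -/
def GrLocalOver (𝒜 : ι → AddSubgroup R) (S : Subalgebra R (FractionRing R)) : Prop :=
  ∃! I : Ideal S, IsGrMaxIdealOver 𝒜 S I

/-- `S` satisfies graded going-down (gGD) over `R`. -/
def GGD (𝒜 : ι → AddSubgroup R) (S : Subalgebra R (FractionRing R)) : Prop :=
  ∀ (P Q : Ideal R) (Qt : Ideal S), P.IsPrime → Q.IsPrime → Qt.IsPrime →
    IsHomIdeal 𝒜 P → IsHomIdeal 𝒜 Q → IsHomIdealOver 𝒜 S Qt → P ≤ Q →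
    Qt.comap (algebraMap R S) = Q →
    ∃ Pt : Ideal S, Pt.IsPrime ∧ IsHomIdealOver 𝒜 S Pt ∧ Pt ≤ Qt ∧
      Pt.comap (algebraMap R S) = P

/-- The overring `S` is a localization of `R` (at some multiplicative subset `W` of `R`). -/
def IsLocalizationOfR (S : Subalgebra R (FractionRing R)) : Prop :=
  ∃ W : Submonoid R, (∀ w ∈ W, IsUnit (algebraMap R S w)) ∧
    ∀ s : S, ∃ (r w : R), w ∈ W ∧ s * algebraMap R S w = algebraMap R S r

/-- `R` is a graded perinormal domain: every gr-local graded overring satisfying gGD is a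
localization of `R`. -/
def GradedPerinormal (𝒜 : ι → AddSubgroup R) : Prop :=
  ∀ S : Subalgebra R (FractionRing R),
    IsGradedOverring 𝒜 S → GrLocalOver 𝒜 S → GGD 𝒜 S → IsLocalizationOfR S

/-- `R` is a graded globally perinormal domain: every graded overring satisfying gGD is a
localization of `R`. -/
def GradedGloballyPerinormal (𝒜 : ι → AddSubgroup R) : Prop :=
  ∀ S : Subalgebra R (FractionRing R),
    IsGradedOverring 𝒜 S → GGD 𝒜 S → IsLocalizationOfR S

/-- The homogeneous localization `R_(P)` of `R` at an ideal `P`: the subring of the graded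
quotient field consisting of fractions with homogeneous denominator outside `P`. -/
def HomLocR (𝒜 : ι → AddSubgroup R) (P : Ideal R) : Subalgebra R (FractionRing R) :=
  Algebra.adjoin R {x : FractionRing R | ∃ a w : R, SetLike.IsHomogeneousElem 𝒜 w ∧ w ∉ P ∧
    x * algebraMap R (FractionRing R) w = algebraMap R (FractionRing R) a}

/-- The homogeneous localization `S_(Q)` of an overring `S` at an ideal `Q` of `S`. -/
def HomLocOver (𝒜 : ι → AddSubgroup R) (S : Subalgebra R (FractionRing R)) (Q : Ideal S) :
    Subalgebra R (FractionRing R) :=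
  Algebra.adjoin R {x : FractionRing R | ∃ s w : S, IsHomFrac 𝒜 (w : FractionRing R) ∧
    w ∉ Q ∧ x * (w : FractionRing R) = (s : FractionRing R)}

/-- The localization `R_W` of `R` at a multiplicative set `W`, as a subring of the quotient
field. -/
def LocW (W : Submonoid R) : Subalgebra R (FractionRing R) :=
  Algebra.adjoin R {x : FractionRing R | ∃ r : R, ∃ w ∈ W,
    x * algebraMap R (FractionRing R) w = algebraMap R (FractionRing R) r}

/-- A subring `V` of the graded quotient field (containing `R`) is a gr-valuation domain:
for every nonzero homogeneous `x` of the graded quotient field, `x ∈ V` or `x⁻¹ ∈ V`. -/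
def GrValuation (𝒜 : ι → AddSubgroup R) (V : Subalgebra R (FractionRing R)) : Prop :=
  ∀ x : FractionRing R, x ≠ 0 → IsHomFrac 𝒜 x → x ∈ V ∨ x⁻¹ ∈ V

/-- `R` is a gr-(R₁) domain: the homogeneous localization at every height-one homogeneous
prime is a gr-valuation domain. -/
def GrR1 (𝒜 : ι → AddSubgroup R) : Prop :=
  ∀ P : Ideal R, HeightOnePrime P → IsHomIdeal 𝒜 P → GrValuation 𝒜 (HomLocR 𝒜 P)

/-- The ideal `I` of `T` is the contraction of the ideal `J` of `S` (that is, `I = J ∩ T`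
inside the common quotient field). -/
def Contracts (T S : Subalgebra R (FractionRing R)) (J : Ideal S) (I : Ideal T) : Prop :=
  ∀ x : FractionRing R,
    (∃ h : x ∈ T, (⟨x, h⟩ : T) ∈ I) ↔ (x ∈ T ∧ ∃ h : x ∈ S, (⟨x, h⟩ : S) ∈ J)

/-- `S` satisfies graded going-down over the intermediate ring `T`. -/
def GGDSub (𝒜 : ι → AddSubgroup R) (T S : Subalgebra R (FractionRing R)) : Prop :=
  ∀ (P Q : Ideal T) (Qt : Ideal S), P.IsPrime → Q.IsPrime → Qt.IsPrime →
    IsHomIdealOver 𝒜 T P → IsHomIdealOver 𝒜 T Q → IsHomIdealOver 𝒜 S Qt → P ≤ Q →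
    Contracts T S Qt Q →
    ∃ Pt : Ideal S, Pt.IsPrime ∧ IsHomIdealOver 𝒜 S Pt ∧ Pt ≤ Qt ∧ Contracts T S Pt P

/-- `S` is a localization of the intermediate ring `T` at a multiplicative subset of `T`. -/
def IsLocalizationOfSub (T S : Subalgebra R (FractionRing R)) : Prop :=
  ∃ W : Submonoid (FractionRing R), (W : Set (FractionRing R)) ⊆ T ∧
    (∀ w ∈ W, ∃ y ∈ S, w * y = 1) ∧ ∀ s ∈ S, ∃ t ∈ T, ∃ w ∈ W, s * w = t

/-- The intermediate ring `T` (e.g. a homogeneous localization of `R`) is a graded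
perinormal domain. -/
def GradedPerinormalSub (𝒜 : ι → AddSubgroup R) (T : Subalgebra R (FractionRing R)) : Prop :=
  ∀ S : Subalgebra R (FractionRing R), T ≤ S → IsGradedOverring 𝒜 S → GrLocalOver 𝒜 S →
    GGDSub 𝒜 T S → IsLocalizationOfSub T S

/-- The intermediate ring `T` is a graded globally perinormal domain. -/
def GradedGloballyPerinormalSub (𝒜 : ι → AddSubgroup R)
    (T : Subalgebra R (FractionRing R)) : Prop :=
  ∀ S : Subalgebra R (FractionRing R), T ≤ S → IsGradedOverring 𝒜 S →
    GGDSub 𝒜 T S → IsLocalizationOfSub T S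

/-- `R` is a gr-essential domain: `R` is the intersection of homogeneous localizations at a
family of homogeneous primes, each of which is a gr-valuation domain. -/
def GrEssential (𝒜 : ι → AddSubgroup R) : Prop :=
  ∃ I : Set (Ideal R),
    (∀ P ∈ I, P.IsPrime ∧ IsHomIdeal 𝒜 P ∧ GrValuation 𝒜 (HomLocR 𝒜 P)) ∧
    ((⊥ : Subalgebra R (FractionRing R)) : Set (FractionRing R)) =
      ⋂ P ∈ I, (HomLocR 𝒜 P : Set (FractionRing R))

/-- The intermediate ring `T` is a gr-essential domain. -/
def GrEssentialSub (𝒜 : ι → AddSubgroup R) (T : Subalgebra R (FractionRing R)) : Prop :=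
  ∃ I : Set (Ideal T),
    (∀ P ∈ I, P.IsPrime ∧ IsHomIdealOver 𝒜 T P ∧ GrValuation 𝒜 (HomLocOver 𝒜 T P)) ∧
    (T : Set (FractionRing R)) = ⋂ P ∈ I, (HomLocOver 𝒜 T P : Set (FractionRing R))

end Core

section Stmt13

/-- A saturated chain of primes of length `n` from `p` to `q`. -/
def IsSatChain {A : Type*} [CommRing A] (p q : Ideal A) (n : ℕ)
    (c : Fin (n + 1) → Ideal A) : Prop :=
  (∀ i, (c i).IsPrime) ∧ c 0 = p ∧ c (Fin.last n) = q ∧ StrictMono c ∧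
    ∀ (i : Fin n) (r : Ideal A), r.IsPrime → c i.castSucc < r → r < c i.succ → False

/-- A catenary ring: any two saturated chains of primes with the same endpoints have the same
length. -/
def IsCatenaryRing (A : Type*) [CommRing A] : Prop :=
  ∀ p q : Ideal A, p.IsPrime → q.IsPrime → p ≤ q →
    ∀ (n m : ℕ) (c : Fin (n + 1) → Ideal A) (d : Fin (m + 1) → Ideal A),
      IsSatChain p q n c → IsSatChain p q m d → n = m

/-- A universally catenary ring: every finitely generated `A`-algebra (i.e. every quotient of
a polynomial ring over `A` in finitely many variables) is catenary. -/
def IsUnivCatenary (A : Type*) [CommRing A] : Prop :=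
  ∀ (k : ℕ) (I : Ideal (MvPolynomial (Fin k) A)), IsCatenaryRing (MvPolynomial (Fin k) A ⧸ I)

variable {ι : Type*} [DecidableEq ι] [AddCommMonoid ι]
variable {R : Type*} [CommRing R] [IsDomain R]

/-- The graded quotient field of `R`, as a subring of the quotient field: the set of finite
sums of homogeneous fractions. -/
def RHfull (𝒜 : ι → AddSubgroup R) : Subalgebra R (FractionRing R) :=
  Algebra.adjoin R {x : FractionRing R | IsHomFrac 𝒜 x}

/-- Contraction of homogeneous primes along `T ≤ S` gives an order-reflecting bijection
`h-Spec(S) → h-Spec(T)`. -/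
def HSpecOrderReflBij (𝒜 : ι → AddSubgroup R) (T S : Subalgebra R (FractionRing R))
    (hTS : T ≤ S) : Prop :=
  (∀ Q : Ideal S, Q.IsPrime → IsHomIdealOver 𝒜 S Q →
      (Q.comap (Subalgebra.inclusion hTS)).IsPrime ∧
      IsHomIdealOver 𝒜 T (Q.comap (Subalgebra.inclusion hTS))) ∧
  (∀ Q₁ Q₂ : Ideal S, Q₁.IsPrime → IsHomIdealOver 𝒜 S Q₁ →
      Q₂.IsPrime → IsHomIdealOver 𝒜 S Q₂ →
      Q₁.comap (Subalgebra.inclusion hTS) = Q₂.comap (Subalgebra.inclusion hTS) → Q₁ = Q₂) ∧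
  (∀ P : Ideal T, P.IsPrime → IsHomIdealOver 𝒜 T P →
      ∃ Q : Ideal S, Q.IsPrime ∧ IsHomIdealOver 𝒜 S Q ∧
        Q.comap (Subalgebra.inclusion hTS) = P) ∧
  (∀ Q₁ Q₂ : Ideal S, Q₁.IsPrime → IsHomIdealOver 𝒜 S Q₁ →
      Q₂.IsPrime → IsHomIdealOver 𝒜 S Q₂ →
      Q₁.comap (Subalgebra.inclusion hTS) ≤ Q₂.comap (Subalgebra.inclusion hTS) → Q₁ ≤ Q₂)

end Stmt13

section Catenary

open Polynomial

theorem IsCatenaryRing.of_ringEquiv {A B : Type*} [CommRing A] [CommRing B] (e : A ≃+* B)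
    (h : IsCatenaryRing A) : IsCatenaryRing B := by
  have key : ∀ (p q : Ideal B) (n : ℕ) (c : Fin (n + 1) → Ideal B), IsSatChain p q n c →
      IsSatChain (p.comap e) (q.comap e) n (fun i => (c i).comap e) := by
    rintro p q n c ⟨h1, h2, h3, h4, h5⟩
    have hlt : ∀ I J : Ideal B, I < J ↔ I.comap e < J.comap e := fun I J => by
      simp only [lt_iff_le_not_ge, Ideal.comap_le_comap_iff_of_surjective e e.surjective]
    refine ⟨fun i => (h1 i).comap e, by simp [h2], by simp [h3], fun i j hij =>
      (hlt _ _).1 (h4 hij), fun i r hr hr1 hr2 => ?_⟩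
    have hrr : r = (r.comap e.symm).comap e := by
      ext x; simp [Ideal.mem_comap]
    rw [hrr] at hr1 hr2
    exact h5 i _ (hr.comap e.symm) ((hlt _ _).2 hr1) ((hlt _ _).2 hr2)
  intro p q hp hq hpq n m c d hc hd
  exact h _ _ (hp.comap e) (hq.comap e) (Ideal.comap_mono hpq) n m _ _ (key _ _ _ _ hc)
    (key _ _ _ _ hd)

theorem IsUnivCatenary.isCatenaryRing_polynomial {R : Type*} [CommRing R]
    (h : IsUnivCatenary R) : IsCatenaryRing R[X] :=
  (h 1 ⊥).of_ringEquiv ((RingEquiv.quotientBot _).trans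
    (MvPolynomial.uniqueAlgEquiv R (Fin 1)).toRingEquiv)

theorem isSatChain_zero {A : Type*} [CommRing A] {p : Ideal A} (hp : p.IsPrime) :
    IsSatChain p p 0 (fun _ => p) :=
  ⟨fun _ => hp, rfl, rfl, Subsingleton.strictMono (α := Fin 1) _,
    fun i => i.elim0⟩

theorem IsSatChain.snoc {A : Type*} [CommRing A] {p q r : Ideal A} {n : ℕ}
    {c : Fin (n + 1) → Ideal A} (h : IsSatChain p q n c) (hr : r.IsPrime) (hqr : q < r)
    (hcov : ∀ s : Ideal A, s.IsPrime → q < s → s < r → False) :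
    IsSatChain p r (n + 1) (Fin.snoc (α := fun _ => Ideal A) c r) := by
  obtain ⟨h1, h2, h3, h4, h5⟩ := h
  refine ⟨fun i => ?_, ?_, by simp, ?_, fun i s hs => ?_⟩
  · induction i using Fin.lastCases with
    | last => simpa using hr
    | cast i => simpa using h1 i
  · rw [← Fin.castSucc_zero, Fin.snoc_castSucc, h2]
  · rw [Fin.strictMono_iff_lt_succ]
    intro i
    induction i using Fin.lastCases with
    | last => simpa [h3] using hqr
    | cast i =>
      rw [Fin.succ_castSucc, Fin.snoc_castSucc, Fin.snoc_castSucc]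
      exact h4 i.castSucc_lt_succ
  · induction i using Fin.lastCases with
    | last => simpa [h3] using hcov s hs
    | cast i =>
      rw [Fin.succ_castSucc, Fin.snoc_castSucc, Fin.snoc_castSucc]
      exact h5 i s hs

/-- A saturated chain ending at `p` extends to a saturated chain ending at any larger prime. -/
theorem IsSatChain.exists_extend {A : Type*} [CommRing A] [IsNoetherianRing A]
    {p₀ p q : Ideal A} {k : ℕ} {c : Fin (k + 1) → Ideal A} (hc : IsSatChain p₀ p k c)
    (hq : q.IsPrime) (hpq : p < q) : ∃ m, k < m ∧ ∃ d, IsSatChain p₀ q m d := by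
  induction hN : q.height using WellFoundedLT.induction generalizing q with
  | ind N ih =>
  have hp : p.IsPrime := hc.2.2.1 ▸ hc.1 _
  obtain ⟨r, ⟨hr, hpr, hrq⟩, hmax⟩ := set_has_maximal_iff_noetherian.mpr
    (inferInstance : IsNoetherian A A) {r : Ideal A | r.IsPrime ∧ p ≤ r ∧ r < q}
    ⟨p, hp, le_rfl, hpq⟩
  have hcov : ∀ s : Ideal A, s.IsPrime → r < s → s < q → False :=
    fun s hs h1 h2 => hmax s ⟨hs, hpr.trans h1.le, h2⟩ h1
  rcases hpr.eq_or_lt with rfl | hlt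
  · exact ⟨k + 1, k.lt_succ_self, _, hc.snoc hq hrq hcov⟩
  · have hht : Ideal.height r < q.height :=
      Ideal.height_strict_mono_of_isPrime_of_isPrime hrq
    obtain ⟨m, hm, d, hd⟩ := ih _ (hN ▸ hht) hr hlt rfl
    exact ⟨m + 1, hm.trans m.lt_succ_self, _, hd.snoc hq hrq hcov⟩

end Catenary

section SimpleExtension

open Polynomial

theorem Polynomial.exists_C_pow_mul_eq_linear_mul_add {R : Type*} [CommRing R] (a b : R)
    (f : R[X]) : ∃ (n : ℕ) (h : R[X]) (c : R),
      C b ^ n * f = (C b * X - C a) * h + C c := by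
  induction f using Polynomial.induction_on' with
  | add f g hf hg =>
    obtain ⟨n, h, c, e⟩ := hf
    obtain ⟨m, h', c', e'⟩ := hg
    refine ⟨n + m, C b ^ m * h + C b ^ n * h', b ^ m * c + b ^ n * c', ?_⟩
    simp only [map_add, map_mul, map_pow]
    linear_combination C b ^ m * e + C b ^ n * e'
  | monomial n r =>
    induction n generalizing r with
    | zero => exact ⟨0, 0, r, by simp⟩
    | succ n ih =>
      obtain ⟨m, h, c, e⟩ := ih r
      refine ⟨m + 1, C b * X * h + C c, a * c, ?_⟩
      rw [← C_mul_X_pow_eq_monomial] at e ⊢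
      simp only [map_mul]
      linear_combination (C b * X) * e

variable {R A : Type*} [CommRing R] [IsDomain R] [CommRing A]

/-- A nonzero prime contained in the kernel of a map from `R[X]` onto a simple birational
extension of `R` is the whole kernel. -/
theorem Polynomial.ker_le_of_isPrime_of_le_ker (φ : R[X] →+* A)
    (hinj : Function.Injective (φ.comp C)) {a b : R} (hb : b ≠ 0)
    (hab : φ (C b) * φ X = φ (C a)) {r : Ideal R[X]} (hr : r.IsPrime) (hr0 : r ≠ ⊥)
    (hrle : r ≤ RingHom.ker φ) : RingHom.ker φ ≤ r := by
  have hC : ∀ c : R, φ (C c) = 0 → c = 0 := fun c hc =>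
    hinj (by simpa using hc)
  have hlin : φ (C b * X - C a) = 0 := by simp [hab]
  have hdiv : ∀ f, φ f = 0 → ∃ (n : ℕ) (h : R[X]), C b ^ n * f = (C b * X - C a) * h := by
    intro f hf
    obtain ⟨n, h, c, e⟩ := Polynomial.exists_C_pow_mul_eq_linear_mul_add a b f
    have : φ (C c) = 0 := by
      have := congrArg φ e
      rw [map_mul, map_add, map_mul, hf, hlin] at this
      simpa using this.symm
    exact ⟨n, h, by rw [e, hC c this]; simp⟩
  have hbr : C b ∉ r := fun h => hb (hC b (hrle h))
  have hmem : C b * X - C a ∈ r := by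
    obtain ⟨g, hg, hg0⟩ := Submodule.exists_mem_ne_zero_of_ne_bot hr0
    induction hd : g.natDegree using Nat.strong_induction_on generalizing g with
    | _ d ih =>
    obtain ⟨n, h, e⟩ := hdiv g (hrle hg)
    have hlin0 : C b * X - C a ≠ 0 := fun h0 => hb (by
      have := congrArg (fun p => coeff p 1) h0
      simpa [coeff_C] using this)
    have hh0 : h ≠ 0 := fun h0 => by
      rw [h0, mul_zero] at e
      exact mul_ne_zero (pow_ne_zero _ (C_ne_zero.2 hb)) hg0 e
    have hdeg : (C b * X - C a).natDegree = 1 := by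
      rw [sub_eq_add_neg, ← C_neg]; exact natDegree_linear hb
    have hdeg2 : g.natDegree = h.natDegree + 1 := by
      have := congrArg natDegree e
      rw [natDegree_mul hlin0 hh0, hdeg, ← C_pow, natDegree_C_mul (pow_ne_zero _ hb)] at this
      omega
    rcases hr.mem_or_mem (e ▸ r.mul_mem_left _ hg) with h1 | h1
    · exact h1
    · exact ih _ (by omega) h h1 hh0 rfl
  intro f hf
  obtain ⟨n, h, e⟩ := hdiv f hf
  refine (hr.mem_or_mem (e ▸ r.mul_mem_right _ hmem)).resolve_left fun h1 => ?_
  exact hbr (hr.mem_of_pow_mem _ h1)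

/-- In a simple birational extension `A` of `R` generated by the image of `X`, the minimal primes
of `X` contract to height-one primes of `R`, provided that `R[X]` is catenary. -/
theorem heightOnePrime_comap_of_mem_minimalPrimes [IsDomain A] [IsNoetherianRing R]
    [IsNoetherianRing A]
    (hcat : IsCatenaryRing R[X]) (φ : R[X] →+* A) (hsurj : Function.Surjective φ)
    (hinj : Function.Injective (φ.comp C)) {a b : R} (hb : b ≠ 0)
    (hab : φ (C b) * φ X = φ (C a)) (hX : φ X ≠ 0) {Q : Ideal A}
    (hQ : Q ∈ (Ideal.span {φ X}).minimalPrimes) :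
    HeightOnePrime (Q.comap (φ.comp C)) := by
  have hQp : Q.IsPrime := hQ.1.1
  have hXQ : φ X ∈ Q := hQ.1.2 (Ideal.mem_span_singleton_self _)
  refine ⟨hQp.comap _, fun h0 => ?_, fun P hP hPQ => ?_⟩
  · have ha : a ∈ Q.comap (φ.comp C) := by
      simpa [Ideal.mem_comap, ← hab] using Q.mul_mem_left _ hXQ
    rw [h0, Ideal.mem_bot] at ha
    have : φ (C b) ≠ 0 := fun h => hb (hinj (by simpa using h))
    rw [ha, map_zero, map_zero] at hab
    exact (mul_ne_zero this hX) hab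
  · by_contra hP0
    have hker : (RingHom.ker φ).IsPrime := RingHom.ker_isPrime φ
    have hQ' : (Q.comap φ).IsPrime := hQp.comap φ
    have hker0 : (⊥ : Ideal R[X]) < RingHom.ker φ := by
      rw [bot_lt_iff_ne_bot]
      intro h
      have h1 : C b * X - C a ∈ RingHom.ker φ := by simp [RingHom.mem_ker, hab]
      rw [h, Ideal.mem_bot] at h1
      have := congrArg (fun p => coeff p 1) h1
      exact hb (by simpa [coeff_C] using this)
    have hkerQ : RingHom.ker φ < Q.comap φ :=
      lt_of_le_of_ne (Ideal.comap_mono bot_le) fun h => hX <| by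
        have : X ∈ Q.comap φ := hXQ
        rwa [← h] at this
    have hbot : (⊥ : Ideal R[X]).IsPrime := Ideal.isPrime_bot
    have chain₁ := (isSatChain_zero hbot).snoc hker hker0 fun s hs h1 h2 =>
      h2.not_ge (Polynomial.ker_le_of_isPrime_of_le_ker φ hinj hb hab hs h1.ne' h2.le)
    have chain₂ := chain₁.snoc hQ' hkerQ fun s hs h1 h2 => by
      have hsmap : (s.map φ).IsPrime := Ideal.map_isPrime_of_surjective hsurj h1.le
      have hcm : (s.map φ).comap φ = s := by
        rw [Ideal.comap_map_of_surjective φ hsurj, sup_eq_left]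
        exact h1.le
      have h3 : s.map φ < Q := by
        refine lt_of_le_of_ne (Ideal.map_le_iff_le_comap.2 h2.le) fun h => h2.ne ?_
        rw [← hcm, h]
      have h4 : (⊥ : Ideal A) < s.map φ := by
        rw [bot_lt_iff_ne_bot]
        intro h
        rw [h] at hcm
        exact h1.ne hcm
      have hb1 := Ideal.height_add_one_le_of_lt_of_isPrime h4
      have hb2 := Ideal.height_add_one_le_of_lt_of_isPrime h3
      have hb3 := Ideal.height_le_one_of_isPrincipal_of_mem_minimalPrimes (Ideal.span {φ X}) Q hQ
      rw [Ideal.height_bot, zero_add] at hb1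
      have h5 : (1 : ℕ∞) + 1 ≤ 1 := (add_le_add_left hb1 1).trans (hb2.trans hb3)
      exact absurd h5 (by decide)
    have hmapC : ∀ I J : Ideal R, I < J → I.map (C : R →+* R[X]) < J.map C := fun I J hIJ => by
      refine lt_of_le_of_ne (Ideal.map_mono hIJ.le) fun h => hIJ.not_ge fun x hx => ?_
      have : C x ∈ I.map (C : R →+* R[X]) := h ▸ Ideal.mem_map_of_mem _ hx
      simpa using Ideal.mem_map_C_iff.1 this 0
    have hcomap : (Q.comap (φ.comp C)).IsPrime := hQp.comap _
    obtain ⟨m₁, hm₁, d₁, hd₁⟩ := (isSatChain_zero hbot).exists_extend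
      (Ideal.isPrime_map_C_of_isPrime (P := P)) (by
        rw [← Ideal.map_bot (f := (C : R →+* R[X]))]
        exact hmapC _ _ (bot_lt_iff_ne_bot.2 hP0))
    obtain ⟨m₂, hm₂, d₂, hd₂⟩ := hd₁.exists_extend
      (Ideal.isPrime_map_C_of_isPrime (P := Q.comap (φ.comp C))) (hmapC _ _ hPQ)
    obtain ⟨m₃, hm₃, d₃, hd₃⟩ := hd₂.exists_extend hQ' <| by
      refine lt_of_le_of_ne (Ideal.map_le_iff_le_comap.2 (by rw [Ideal.comap_comap])) fun h => ?_
      have : X ∈ (Q.comap (φ.comp C)).map C := h ▸ (hXQ : X ∈ Q.comap φ)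
      have h1 := Ideal.mem_map_C_iff.1 this 1
      rw [coeff_X_one] at h1
      exact hcomap.ne_top ((Ideal.eq_top_iff_one _).2 h1)
    have := hcat _ _ hbot hQ' bot_le _ _ _ _ chain₂ hd₃
    omega

end SimpleExtension

section GradedFractions

open DirectSum

variable {R : Type*} [CommRing R] {𝒜 : ℤ → AddSubgroup R}

/-- The grading of the ring underlying `IsGrRing`, as Mathlib's data-carrying structure. -/
@[reducible]
noncomputable def IsGrRing.gradedRing (hGr : IsGrRing 𝒜) : GradedRing 𝒜 where
  one_mem := hGr.one_mem
  mul_mem _ _ _ _ := hGr.mul_mem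
  toDecomposition := hGr.internal.chooseDecomposition

theorem algebraMap_fractionRing_ne_zero {b : R} (hb : b ≠ 0) :
    algebraMap R (FractionRing R) b ≠ 0 := by
  simpa using hb

theorem IsGrRing.eq_zero_of_sum_eq_zero (hGr : IsGrRing 𝒜) {s : Finset ℤ} {a : ℤ → R} {d : ℤ}
    (ha : ∀ n ∈ s, a n ∈ 𝒜 (n + d)) (h0 : ∑ n ∈ s, a n = 0) : ∀ n ∈ s, a n = 0 := by
  classical
  let := hGr.gradedRing
  intro m hm
  have h := congrArg (fun x => (decompose 𝒜 x (m + d) : R)) h0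
  simp only [decompose_sum, AddSubgroup.val_finsetSum,
    decompose_zero, DirectSum.zero_apply, ZeroMemClass.coe_zero, DirectSum.sum_apply] at h
  rw [Finset.sum_eq_single m] at h
  · rwa [decompose_of_mem_same _ (ha m hm)] at h
  · intro n hn hne
    exact decompose_of_mem_ne 𝒜 (ha n hn) fun h => hne (add_right_cancel h)
  · exact fun h => absurd hm h

variable [IsDomain R]

/-- The degree `n` part of the graded quotient field. -/
def IsGrRing.fracComponent (hGr : IsGrRing 𝒜) (n : ℤ) : AddSubgroup (FractionRing R) where
  carrier := {x | ∃ (j : ℤ) (a b : R), a ∈ 𝒜 (n + j) ∧ b ∈ 𝒜 j ∧ b ≠ 0 ∧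
    x * algebraMap R (FractionRing R) b = algebraMap R (FractionRing R) a}
  zero_mem' := ⟨0, 0, 1, zero_mem _, hGr.one_mem, one_ne_zero, by simp⟩
  neg_mem' := by
    rintro x ⟨j, a, b, ha, hb, hb0, h⟩
    exact ⟨j, -a, b, neg_mem ha, hb, hb0, by simp [← h]⟩
  add_mem' := by
    rintro x y ⟨j, a, b, ha, hb, hb0, h⟩ ⟨k, c, d, hc, hd, hd0, h'⟩
    refine ⟨j + k, a * d + c * b, b * d, add_mem ?_ ?_, hGr.mul_mem hb hd, mul_ne_zero hb0 hd0, ?_⟩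
    · rw [← add_assoc]; exact hGr.mul_mem ha hd
    · rw [add_comm j, ← add_assoc]; exact hGr.mul_mem hc hb
    · simp only [map_add, map_mul, ← h, ← h']; ring

theorem isHomFrac_iff (hGr : IsGrRing 𝒜) {x : FractionRing R} :
    IsHomFrac 𝒜 x ↔ ∃ n, x ∈ hGr.fracComponent n := by
  constructor
  · rintro ⟨i, j, a, b, ha, hb, hb0, h⟩
    exact ⟨i - j, j, a, b, by simpa using ha, hb, hb0, h⟩
  · rintro ⟨n, j, a, b, ha, hb, hb0, h⟩
    exact ⟨n + j, j, a, b, ha, hb, hb0, h⟩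

theorem IsGrRing.fracComponent_mul_mem (hGr : IsGrRing 𝒜) {m n : ℤ} {x y : FractionRing R}
    (hx : x ∈ hGr.fracComponent m) (hy : y ∈ hGr.fracComponent n) :
    x * y ∈ hGr.fracComponent (m + n) := by
  obtain ⟨j, a, b, ha, hb, hb0, h⟩ := hx
  obtain ⟨k, c, d, hc, hd, hd0, h'⟩ := hy
  refine ⟨j + k, a * c, b * d, ?_, hGr.mul_mem hb hd, mul_ne_zero hb0 hd0, ?_⟩
  · rw [add_add_add_comm]; exact hGr.mul_mem ha hc
  · simp only [map_mul, ← h, ← h']; ring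

theorem IsGrRing.algebraMap_mem_fracComponent (hGr : IsGrRing 𝒜) {n : ℤ} {a : R}
    (ha : a ∈ 𝒜 n) : algebraMap R (FractionRing R) a ∈ hGr.fracComponent n :=
  ⟨0, a, 1, by simpa using ha, hGr.one_mem, one_ne_zero, by simp⟩

theorem IsHomFrac.mul (hGr : IsGrRing 𝒜) {x y : FractionRing R} (hx : IsHomFrac 𝒜 x)
    (hy : IsHomFrac 𝒜 y) : IsHomFrac 𝒜 (x * y) := by
  rw [isHomFrac_iff hGr] at *
  exact ⟨_, hGr.fracComponent_mul_mem hx.choose_spec hy.choose_spec⟩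

theorem IsHomFrac.inv {x : FractionRing R} (hx0 : x ≠ 0)
    (hx : IsHomFrac 𝒜 x) : IsHomFrac 𝒜 x⁻¹ := by
  obtain ⟨i, j, a, b, ha, hb, hb0, h⟩ := hx
  have ha0 : a ≠ 0 := by
    rintro rfl
    rw [map_zero] at h
    exact mul_ne_zero hx0 (algebraMap_fractionRing_ne_zero hb0) h
  exact ⟨j, i, b, a, hb, ha, ha0, by rw [← h]; field_simp⟩

theorem IsGrRing.isHomFrac_algebraMap (hGr : IsGrRing 𝒜) {a : R}
    (ha : SetLike.IsHomogeneousElem 𝒜 a) : IsHomFrac 𝒜 (algebraMap R (FractionRing R) a) :=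
  (isHomFrac_iff hGr).2 ⟨_, hGr.algebraMap_mem_fracComponent ha.choose_spec⟩

theorem IsGrRing.exists_common_denominator (hGr : IsGrRing 𝒜) (s : Finset ℤ)
    (f : ℤ → FractionRing R) (hf : ∀ n, f n ∈ hGr.fracComponent n) :
    ∃ (d : ℤ) (b : R), b ∈ 𝒜 d ∧ b ≠ 0 ∧ ∃ a : ℤ → R, ∀ n ∈ s, a n ∈ 𝒜 (n + d) ∧
      f n * algebraMap R (FractionRing R) b = algebraMap R (FractionRing R) (a n) := by
  classical
  induction s using Finset.induction_on with
  | empty => exact ⟨0, 1, hGr.one_mem, one_ne_zero, 0, by simp⟩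
  | insert m s hm ih =>
    obtain ⟨d, b, hb, hb0, a, ha⟩ := ih
    obtain ⟨j, a', b', ha', hb', hb'0, h'⟩ := hf m
    refine ⟨d + j, b * b', hGr.mul_mem hb hb', mul_ne_zero hb0 hb'0,
      fun n => if n = m then a' * b else a n * b', fun n hn => ?_⟩
    rcases Finset.mem_insert.1 hn with rfl | hn
    · refine ⟨?_, ?_⟩
      · simp only [if_pos]; rw [add_comm d, ← add_assoc]; exact hGr.mul_mem ha' hb
      · simp only [if_pos, map_mul, ← h']; ring
    · have hne : n ≠ m := fun h => hm (h ▸ hn)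
      refine ⟨?_, ?_⟩
      · simp only [if_neg hne]; rw [← add_assoc]; exact hGr.mul_mem (ha n hn).1 hb'
      · simp only [if_neg hne, map_mul, ← (ha n hn).2]; ring

theorem IsGrRing.frac_eq_zero_of_sum_eq_zero (hGr : IsGrRing 𝒜) {s : Finset ℤ}
    {f : ℤ → FractionRing R} (hf : ∀ n, f n ∈ hGr.fracComponent n)
    (h0 : ∑ n ∈ s, f n = 0) : ∀ n ∈ s, f n = 0 := by
  obtain ⟨d, b, hb, hb0, a, ha⟩ := hGr.exists_common_denominator s f hf
  have hsum : ∑ n ∈ s, a n = 0 := by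
    apply IsFractionRing.injective R (FractionRing R)
    rw [map_sum, map_zero, ← Finset.sum_congr rfl fun n hn => (ha n hn).2, ← Finset.sum_mul, h0,
      zero_mul]
  intro n hn
  have h := (ha n hn).2
  rw [hGr.eq_zero_of_sum_eq_zero (fun n hn => (ha n hn).1) hsum n hn, map_zero] at h
  exact (mul_eq_zero.1 h).resolve_right (algebraMap_fractionRing_ne_zero hb0)

/-- The degree `n` part of an overring. -/
def IsGrRing.overComponent (hGr : IsGrRing 𝒜) (S : Subalgebra R (FractionRing R)) (n : ℤ) :
    AddSubgroup S :=
  (hGr.fracComponent n).comap (S.val : S →+ FractionRing R)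

theorem IsGrRing.mem_overComponent (hGr : IsGrRing 𝒜) {S : Subalgebra R (FractionRing R)} {n : ℤ}
    {x : S} : x ∈ hGr.overComponent S n ↔ (x : FractionRing R) ∈ hGr.fracComponent n := Iff.rfl

theorem IsGrRing.isHomogeneousElem_over (hGr : IsGrRing 𝒜) {S : Subalgebra R (FractionRing R)}
    {x : S} : SetLike.IsHomogeneousElem (hGr.overComponent S) x ↔
      IsHomFrac 𝒜 (x : FractionRing R) :=
  (isHomFrac_iff hGr).symm

theorem IsGradedOverring.isInternal {S : Subalgebra R (FractionRing R)}
    (hS : IsGradedOverring 𝒜 S) (hGr : IsGrRing 𝒜) :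
    DirectSum.IsInternal (hGr.overComponent S) := by
  classical
  constructor
  · rw [injective_iff_map_eq_zero]
    intro x hx
    have h := congrArg (fun y : S => (y : FractionRing R)) hx
    simp only [coeAddMonoidHom_eq_dfinsuppSum, DFinsupp.sum, AddSubmonoidClass.coe_finsetSum,
      ZeroMemClass.coe_zero] at h
    have h' := hGr.frac_eq_zero_of_sum_eq_zero (f := fun n => ((x n : S) : FractionRing R))
      (fun n => (x n).2) h
    ext n
    by_cases hn : n ∈ DFinsupp.support x
    · exact h' n hn
    · simp only [DFinsupp.mem_support_toFun, not_not] at hn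
      simp [hn]
  · intro x
    have key : AddSubmonoid.closure {y : FractionRing R | y ∈ S ∧ IsHomFrac 𝒜 y} ≤
        (AddMonoidHom.mrange (DirectSum.coeAddMonoidHom (hGr.overComponent S))).map
          (S.val : S →+ FractionRing R) := by
      rw [AddSubmonoid.closure_le]
      rintro y ⟨hyS, hy⟩
      obtain ⟨n, hn⟩ := (isHomFrac_iff hGr).1 hy
      exact ⟨⟨y, hyS⟩, ⟨DirectSum.of (fun n => hGr.overComponent S n) n ⟨⟨y, hyS⟩, hn⟩,
        by simp⟩, rfl⟩
    obtain ⟨z, hz, hzx⟩ := key (hS x x.2)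
    rw [← Subtype.ext (a1 := z) (a2 := x) hzx]
    exact hz

/-- A graded overring as a graded ring in the sense of Mathlib. -/
@[reducible]
noncomputable def IsGradedOverring.gradedRing {S : Subalgebra R (FractionRing R)}
    (hS : IsGradedOverring 𝒜 S) (hGr : IsGrRing 𝒜) : GradedRing (hGr.overComponent S) where
  one_mem := by
    simpa [hGr.mem_overComponent] using hGr.algebraMap_mem_fracComponent hGr.one_mem
  mul_mem _ _ _ _ h h' := hGr.fracComponent_mul_mem h h'
  toDecomposition := (hS.isInternal hGr).chooseDecomposition

end GradedFractions

section HomogeneousIdeals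

open DirectSum

theorem isHomIdeal_iff_isHomogeneous {B : Type*} [CommRing B] {ℬ : ℤ → AddSubgroup B}
    [GradedRing ℬ] {I : Ideal B} : IsHomIdeal ℬ I ↔ I.IsHomogeneous ℬ := by
  classical
  constructor
  · intro h
    have hspan : I = Ideal.span {y | SetLike.IsHomogeneousElem ℬ y ∧ y ∈ I} := by
      refine le_antisymm (fun x hx => ?_) (Ideal.span_le.2 fun y hy => hy.2)
      exact (AddSubmonoid.closure_le (S := (Ideal.span
        {y | SetLike.IsHomogeneousElem ℬ y ∧ y ∈ I}).toAddSubmonoid)).2 Ideal.subset_span (h x hx)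
    rw [hspan]
    exact Ideal.homogeneous_span _ _ fun x hx => hx.1
  · intro h x hx
    rw [← sum_support_decompose ℬ x]
    exact sum_mem fun i _ => AddSubmonoid.subset_closure
      ⟨SetLike.isHomogeneousElem_coe _, h i hx⟩

variable {R : Type*} [CommRing R] {𝒜 : ℤ → AddSubgroup R}
  {S T : Subalgebra R (FractionRing R)}

/-- A homogeneous ideal is determined by its homogeneous elements. -/
theorem IsHomIdealOver.le_of_forall {I J : Ideal S} (hI : IsHomIdealOver 𝒜 S I)
    (h : ∀ x ∈ I, IsHomFrac 𝒜 (x : FractionRing R) → x ∈ J) : I ≤ J := by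
  intro x hx
  have hle : AddSubmonoid.closure
      {y : FractionRing R | IsHomFrac 𝒜 y ∧ ∃ h : y ∈ S, (⟨y, h⟩ : S) ∈ I} ≤
      J.toAddSubmonoid.map (S.val : S →+ FractionRing R) := by
    rw [AddSubmonoid.closure_le]
    rintro y ⟨hy, hyS, hyI⟩
    exact ⟨⟨y, hyS⟩, h _ hyI hy, rfl⟩
  obtain ⟨z, hz, hzx⟩ := hle (hI x hx)
  rwa [← Subtype.ext (a1 := z) (a2 := x) hzx]

theorem isHomIdealOver_bot : IsHomIdealOver 𝒜 S ⊥ := by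
  intro x hx
  rw [Ideal.mem_bot] at hx
  subst hx
  exact zero_mem _

theorem grLocalOver_of_forall_le {N : Ideal S} (hN : IsHomIdealOver 𝒜 S N) (hNt : N ≠ ⊤)
    (h : ∀ J : Ideal S, IsHomIdealOver 𝒜 S J → J ≠ ⊤ → J ≤ N) : GrLocalOver 𝒜 S :=
  ⟨N, ⟨hN, hNt, fun J hJ hle hJt => le_antisymm (h J hJ hJt) hle⟩,
    fun J hJ => (hJ.2.2 N hN (h J hJ.1 hJ.2.1) hNt).symm⟩

variable [IsDomain R]

theorem isHomIdealOver_iff_isHomIdeal (hGr : IsGrRing 𝒜) {I : Ideal S} :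
    IsHomIdealOver 𝒜 S I ↔ IsHomIdeal (hGr.overComponent S) I := by
  have himage : {y : FractionRing R | IsHomFrac 𝒜 y ∧ ∃ h : y ∈ S, (⟨y, h⟩ : S) ∈ I} =
      (S.val : S →+ FractionRing R) ''
        {y : S | SetLike.IsHomogeneousElem (hGr.overComponent S) y ∧ y ∈ I} := by
    ext y
    constructor
    · rintro ⟨hy, hyS, hyI⟩
      exact ⟨⟨y, hyS⟩, ⟨hGr.isHomogeneousElem_over.2 hy, hyI⟩, rfl⟩
    · rintro ⟨y, ⟨hy, hyI⟩, rfl⟩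
      exact ⟨hGr.isHomogeneousElem_over.1 hy, y.2, hyI⟩
  refine forall₂_congr fun x _ => ?_
  rw [himage, ← AddMonoidHom.map_mclosure]
  exact AddSubmonoid.mem_map_iff_mem (f := (S.val : S →+ FractionRing R)) Subtype.val_injective

theorem isHomIdealOver_iff_isHomogeneous (hGr : IsGrRing 𝒜) [GradedRing (hGr.overComponent S)]
    {I : Ideal S} : IsHomIdealOver 𝒜 S I ↔ I.IsHomogeneous (hGr.overComponent S) :=
  (isHomIdealOver_iff_isHomIdeal hGr).trans isHomIdeal_iff_isHomogeneous

theorem coe_decompose_map {B C : Type*} [CommRing B] [CommRing C]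
    {ℬ : ℤ → AddSubgroup B} {𝒞 : ℤ → AddSubgroup C} [GradedRing ℬ] [GradedRing 𝒞]
    (f : B →+* C) (hf : ∀ i, ∀ x ∈ ℬ i, f x ∈ 𝒞 i) (x : B) (i : ℤ) :
    (decompose 𝒞 (f x) i : C) = f (decompose ℬ x i) :=
  let g : ℬ →+*ᵍ 𝒞 := { f with map_mem := fun {i x} hx => hf i x hx }
  (GradedRingHom.map_directSumDecompose ℬ 𝒞 g (x := x) (i := i)).symm

theorem Ideal.IsHomogeneous.comap_of_map_mem {B C : Type*} [CommRing B] [CommRing C]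
    {ℬ : ℤ → AddSubgroup B} {𝒞 : ℤ → AddSubgroup C} [GradedRing ℬ] [GradedRing 𝒞]
    {I : Ideal C} (hI : I.IsHomogeneous 𝒞) (f : B →+* C) (hf : ∀ i, ∀ x ∈ ℬ i, f x ∈ 𝒞 i) :
    (I.comap f).IsHomogeneous ℬ := by
  intro i x hx
  rw [Ideal.mem_comap, ← coe_decompose_map (𝒞 := 𝒞) f hf]
  exact hI i hx

theorem IsHomIdealOver.comap_inclusion (hGr : IsGrRing 𝒜) (hS : IsGradedOverring 𝒜 S)
    (hT : IsGradedOverring 𝒜 T) (hTS : T ≤ S) {I : Ideal S} (hI : IsHomIdealOver 𝒜 S I) :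
    IsHomIdealOver 𝒜 T (I.comap (Subalgebra.inclusion hTS)) := by
  let := hS.gradedRing hGr
  let := hT.gradedRing hGr
  rw [isHomIdealOver_iff_isHomogeneous hGr] at *
  exact hI.comap_of_map_mem (Subalgebra.inclusion hTS : T →+* S) fun i x hx => hx

theorem IsHomIdealOver.comap_algebraMap (hGr : IsGrRing 𝒜) (hS : IsGradedOverring 𝒜 S)
    {I : Ideal S} (hI : IsHomIdealOver 𝒜 S I) :
    IsHomIdeal 𝒜 (I.comap (algebraMap R S)) := by
  let := hS.gradedRing hGr
  let := hGr.gradedRing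
  rw [isHomIdealOver_iff_isHomogeneous hGr] at hI
  rw [isHomIdeal_iff_isHomogeneous]
  exact hI.comap_of_map_mem (algebraMap R S) fun i x hx => hGr.algebraMap_mem_fracComponent hx

theorem isHomIdealOver_span_singleton (hGr : IsGrRing 𝒜) (hS : IsGradedOverring 𝒜 S) {x : S}
    (hx : IsHomFrac 𝒜 (x : FractionRing R)) : IsHomIdealOver 𝒜 S (Ideal.span {x}) := by
  let := hS.gradedRing hGr
  rw [isHomIdealOver_iff_isHomogeneous hGr]
  refine Ideal.homogeneous_span _ _ fun y hy => ?_
  rw [Set.mem_singleton_iff.1 hy]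
  exact hGr.isHomogeneousElem_over.2 hx

/-- Every prime of a graded overring contains a homogeneous prime with the same homogeneous
elements. -/
theorem IsGradedOverring.exists_core (hGr : IsGrRing 𝒜) (hS : IsGradedOverring 𝒜 S)
    {Q : Ideal S} (hQ : Q.IsPrime) : ∃ P : Ideal S, P.IsPrime ∧ IsHomIdealOver 𝒜 S P ∧ P ≤ Q ∧
      ∀ x ∈ Q, IsHomFrac 𝒜 (x : FractionRing R) → x ∈ P := by
  let := hS.gradedRing hGr
  refine ⟨_, hQ.homogeneousCore (𝒜 := hGr.overComponent S), ?_,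
    Ideal.toIdeal_homogeneousCore_le _ _, fun x hx hxh => ?_⟩
  · rw [isHomIdealOver_iff_isHomogeneous hGr]
    exact HomogeneousIdeal.isHomogeneous _
  · exact Ideal.mem_homogeneousCore_of_homogeneous_of_mem (hGr.isHomogeneousElem_over.2 hxh) hx

theorem IsGradedOverring.isHomIdealOver_of_mem_minimalPrimes (hGr : IsGrRing 𝒜)
    (hS : IsGradedOverring 𝒜 S) {x : S} (hx : IsHomFrac 𝒜 (x : FractionRing R)) {Q : Ideal S}
    (hQ : Q ∈ (Ideal.span {x}).minimalPrimes) : IsHomIdealOver 𝒜 S Q := by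
  obtain ⟨P, hP, hPh, hPQ, hP'⟩ := hS.exists_core hGr hQ.1.1
  have hxP : x ∈ P := hP' x (hQ.1.2 (Ideal.mem_span_singleton_self x)) hx
  rwa [le_antisymm (hQ.2 ⟨hP, (Ideal.span_singleton_le_iff_mem _).2 hxP⟩ hPQ) hPQ]

theorem IsGradedOverring.exists_le_isGrMaxIdealOver (hGr : IsGrRing 𝒜)
    (hS : IsGradedOverring 𝒜 S) {J : Ideal S} (hJ : IsHomIdealOver 𝒜 S J) (hJt : J ≠ ⊤) :
    ∃ N, J ≤ N ∧ IsGrMaxIdealOver 𝒜 S N := by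
  let := hS.gradedRing hGr
  obtain ⟨N, hJN, hN⟩ := zorn_le_nonempty₀ {I : Ideal S | IsHomIdealOver 𝒜 S I ∧ I ≠ ⊤}
    (fun c hc hchain I hI => by
      refine ⟨sSup c, ⟨?_, fun htop => ?_⟩, fun I hI => le_sSup hI⟩
      · rw [isHomIdealOver_iff_isHomogeneous hGr]
        exact Ideal.IsHomogeneous.sSup fun I hI =>
          (isHomIdealOver_iff_isHomogeneous hGr).1 (hc hI).1
      · obtain ⟨I', hI', h1⟩ := (Submodule.mem_sSup_of_directed ⟨I, hI⟩ hchain.directedOn).1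
          ((Ideal.eq_top_iff_one _).1 htop)
        exact (hc hI').2 ((Ideal.eq_top_iff_one _).2 h1)) J ⟨hJ, hJt⟩
  exact ⟨N, hJN, hN.1.1, hN.1.2, fun I hI hle hIt => le_antisymm (hN.2 ⟨hI, hIt⟩ hle) hle⟩

theorem IsGrMaxIdealOver.isPrime (hGr : IsGrRing 𝒜) (hS : IsGradedOverring 𝒜 S) {N : Ideal S}
    (hN : IsGrMaxIdealOver 𝒜 S N) : N.IsPrime := by
  obtain ⟨M, hM, hNM⟩ := Ideal.exists_le_maximal N hN.2.1
  obtain ⟨P, hP, hPh, -, hP'⟩ := hS.exists_core hGr hM.isPrime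
  have hNP : N ≤ P := hN.1.le_of_forall fun x hx hxh => hP' x (hNM hx) hxh
  rwa [← hN.2.2 P hPh hNP hP.ne_top]

/-- In a gr-local overring, homogeneous elements outside the graded maximal ideal are units. -/
theorem isUnit_of_notMem_isGrMaxIdealOver (hGr : IsGrRing 𝒜) (hS : IsGradedOverring 𝒜 S)
    (hloc : GrLocalOver 𝒜 S) {N : Ideal S} (hN : IsGrMaxIdealOver 𝒜 S N) {x : S}
    (hx : IsHomFrac 𝒜 (x : FractionRing R)) (hxN : x ∉ N) : IsUnit x := by
  by_contra hu
  obtain ⟨N', hle, hN'⟩ := hS.exists_le_isGrMaxIdealOver hGr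
    (isHomIdealOver_span_singleton hGr hS hx) (fun h => hu (Ideal.span_singleton_eq_top.1 h))
  rw [hloc.unique hN' hN] at hle
  exact hxN (hle (Ideal.mem_span_singleton_self x))

end HomogeneousIdeals

section HomogeneousLocalization

open DirectSum

variable {R : Type*} [CommRing R] {𝒜 : ℤ → AddSubgroup R}

theorem IsHomIdeal.le_of_forall {I J : Ideal R} (hI : IsHomIdeal 𝒜 I)
    (h : ∀ x ∈ I, SetLike.IsHomogeneousElem 𝒜 x → x ∈ J) : I ≤ J := fun x hx =>
  (AddSubmonoid.closure_le (S := J.toAddSubmonoid)).2 (fun y hy => h y hy.2 hy.1) (hI x hx)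

/-- The homogeneous elements outside a prime ideal. -/
def IsGrRing.homCompl (hGr : IsGrRing 𝒜) (p : Ideal R) [p.IsPrime] : Submonoid R where
  carrier := {w | SetLike.IsHomogeneousElem 𝒜 w ∧ w ∉ p}
  one_mem' := ⟨⟨0, hGr.one_mem⟩, fun h => Ideal.IsPrime.ne_top' ((Ideal.eq_top_iff_one p).2 h)⟩
  mul_mem' := by
    rintro a b ⟨⟨i, hi⟩, ha⟩ ⟨⟨j, hj⟩, hb⟩
    exact ⟨⟨i + j, hGr.mul_mem hi hj⟩, fun h => (Ideal.IsPrime.mem_or_mem ‹_› h).elim ha hb⟩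

theorem IsGradedOverring.le_of_forall {S T : Subalgebra R (FractionRing R)}
    (hS : IsGradedOverring 𝒜 S) (h : ∀ x ∈ S, IsHomFrac 𝒜 x → x ∈ T) : S ≤ T := fun x hx =>
  (AddSubmonoid.closure_le (S := T.toSubring.toAddSubgroup.toAddSubmonoid)).2
    (fun y hy => h y hy.1 hy.2) (hS x hx)

theorem mem_homLocR_iff (hGr : IsGrRing 𝒜) {p : Ideal R} [p.IsPrime] {x : FractionRing R} :
    x ∈ HomLocR 𝒜 p ↔ ∃ a, ∃ w ∈ hGr.homCompl p,
      x * algebraMap R (FractionRing R) w = algebraMap R (FractionRing R) a := by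
  constructor
  · intro hx
    induction hx using Algebra.adjoin_induction with
    | mem x hx =>
      obtain ⟨a, w, hw, hwp, h⟩ := hx
      exact ⟨a, w, ⟨hw, hwp⟩, h⟩
    | algebraMap r => exact ⟨r, 1, one_mem _, by simp⟩
    | add x y _ _ hx hy =>
      obtain ⟨a, v, hv, h⟩ := hx
      obtain ⟨b, w, hw, h'⟩ := hy
      exact ⟨a * w + b * v, v * w, mul_mem hv hw, by simp only [map_mul, map_add, ← h, ← h']; ring⟩
    | mul x y _ _ hx hy =>
      obtain ⟨a, v, hv, h⟩ := hx
      obtain ⟨b, w, hw, h'⟩ := hy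
      exact ⟨a * b, v * w, mul_mem hv hw, by simp only [map_mul, ← h, ← h']; ring⟩
  · rintro ⟨a, w, hw, h⟩
    exact Algebra.subset_adjoin ⟨a, w, hw.1, hw.2, h⟩

theorem ne_zero_of_notMem {p : Ideal R} {w : R} (hw : w ∉ p) : w ≠ 0 :=
  fun h => hw (h ▸ p.zero_mem)

theorem IsGradedOverring.le_RHfull {S : Subalgebra R (FractionRing R)}
    (hS : IsGradedOverring 𝒜 S) : S ≤ RHfull 𝒜 :=
  hS.le_of_forall fun _ _ hx => Algebra.subset_adjoin hx

theorem comap_inclusion_comap_algebraMap {T S : Subalgebra R (FractionRing R)} (hTS : T ≤ S)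
    (Q : Ideal S) : (Q.comap (Subalgebra.inclusion hTS)).comap (algebraMap R T) =
      Q.comap (algebraMap R S) := rfl

variable [IsDomain R]

theorem isGradedOverring_adjoin (hGr : IsGrRing 𝒜) {s : Set (FractionRing R)}
    (hs : ∀ x ∈ s, x ∈ AddSubmonoid.closure
      {y : FractionRing R | y ∈ Algebra.adjoin R s ∧ IsHomFrac 𝒜 y}) :
    IsGradedOverring 𝒜 (Algebra.adjoin R s) := by
  classical
  let := hGr.gradedRing
  intro x hx
  induction hx using Algebra.adjoin_induction with
  | mem x hx => exact hs x hx
  | algebraMap r =>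
    rw [← sum_support_decompose 𝒜 r, map_sum]
    exact sum_mem fun i _ => AddSubmonoid.subset_closure
      ⟨Subalgebra.algebraMap_mem _ _, hGr.isHomFrac_algebraMap (SetLike.isHomogeneousElem_coe _)⟩
  | add x y _ _ hx hy => exact add_mem hx hy
  | mul x y hxs hys hx hy =>
    clear hxs hys
    induction hx, hy using AddSubmonoid.closure_induction₂ with
    | mem a b ha hb =>
      exact AddSubmonoid.subset_closure ⟨mul_mem ha.1 hb.1, ha.2.mul hGr hb.2⟩
    | zero_left b _ => rw [zero_mul]; exact zero_mem _
    | zero_right a _ => rw [mul_zero]; exact zero_mem _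
    | add_left a b c _ _ _ hac hbc => rw [add_mul]; exact add_mem hac hbc
    | add_right a b c _ _ _ hab hac => rw [mul_add]; exact add_mem hab hac

theorem isGradedOverring_adjoin_of_isHomFrac (hGr : IsGrRing 𝒜) {s : Set (FractionRing R)}
    (hs : ∀ x ∈ s, IsHomFrac 𝒜 x) : IsGradedOverring 𝒜 (Algebra.adjoin R s) :=
  isGradedOverring_adjoin hGr fun x hx =>
    AddSubmonoid.subset_closure ⟨Algebra.subset_adjoin hx, hs x hx⟩

theorem isGradedOverring_homLocR (hGr : IsGrRing 𝒜) (p : Ideal R) :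
    IsGradedOverring 𝒜 (HomLocR 𝒜 p) := by
  classical
  let := hGr.gradedRing
  refine isGradedOverring_adjoin hGr ?_
  rintro x ⟨a, w, ⟨j, hw⟩, hwp, h⟩
  have hw0 := algebraMap_fractionRing_ne_zero (ne_zero_of_notMem hwp)
  rw [eq_div_of_mul_eq hw0 h, ← sum_support_decompose 𝒜 a, map_sum, Finset.sum_div]
  refine sum_mem fun i _ => AddSubmonoid.subset_closure ⟨Algebra.subset_adjoin
    ⟨decompose 𝒜 a i, w, ⟨j, hw⟩, hwp, div_mul_cancel₀ _ hw0⟩, i, j, decompose 𝒜 a i, w,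
    SetLike.coe_mem _, hw, ne_zero_of_notMem hwp, div_mul_cancel₀ _ hw0⟩

theorem isUnit_algebraMap_of_mul_eq_one {S : Subalgebra R (FractionRing R)} {w : R} (hw : w ≠ 0)
    (h : (algebraMap R (FractionRing R) w)⁻¹ ∈ S) : IsUnit (algebraMap R S w) :=
  IsUnit.of_mul_eq_one ⟨_, h⟩ (Subtype.ext (mul_inv_cancel₀ (algebraMap_fractionRing_ne_zero hw)))

theorem isLocalization_homLocR (hGr : IsGrRing 𝒜) (p : Ideal R) [p.IsPrime] :
    IsLocalization (hGr.homCompl p) (HomLocR 𝒜 p) where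
  map_units w := isUnit_algebraMap_of_mul_eq_one (ne_zero_of_notMem w.2.2)
    ((mem_homLocR_iff hGr).2 ⟨1, w, w.2, by
      rw [map_one, inv_mul_cancel₀ (algebraMap_fractionRing_ne_zero (ne_zero_of_notMem w.2.2))]⟩)
  surj x := by
    obtain ⟨a, w, hw, h⟩ := (mem_homLocR_iff hGr).1 x.2
    exact ⟨(a, ⟨w, hw⟩), Subtype.ext h⟩
  exists_of_eq {x y} h := by
    refine ⟨1, ?_⟩
    rw [IsFractionRing.injective R (FractionRing R) (congrArg Subtype.val h)]

theorem isLocalizationOfR_homLocR (hGr : IsGrRing 𝒜) (p : Ideal R) [p.IsPrime] :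
    IsLocalizationOfR (HomLocR 𝒜 p) := by
  have := isLocalization_homLocR hGr p
  refine ⟨hGr.homCompl p, fun w hw => IsLocalization.map_units _ (⟨w, hw⟩ : hGr.homCompl p),
    fun s => ?_⟩
  obtain ⟨⟨a, w⟩, h⟩ := IsLocalization.surj (hGr.homCompl p) s
  exact ⟨a, w, w.2, h⟩

/-- A graded localization of `R` having a proper ideal that lies over a prime containing `p` is
contained in the homogeneous localization at `p`. -/
theorem IsLocalizationOfR.le_homLocR (hGr : IsGrRing 𝒜) {S : Subalgebra R (FractionRing R)}
    (hloc : IsLocalizationOfR S) (hS : IsGradedOverring 𝒜 S) {p : Ideal R} [p.IsPrime]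
    {N : Ideal S} (hN : N ≠ ⊤) (hpN : p ≤ N.comap (algebraMap R S)) : S ≤ HomLocR 𝒜 p := by
  classical
  obtain ⟨W, hW, hsurj⟩ := hloc
  let := hGr.gradedRing
  let := hS.gradedRing hGr
  refine hS.le_of_forall fun y hy hyh => ?_
  obtain ⟨n, hn⟩ := (isHomFrac_iff hGr).1 hyh
  obtain ⟨r, w, hw, h⟩ := hsurj ⟨y, hy⟩
  have hwp : w ∉ p := fun hwp => hN (Ideal.eq_top_of_isUnit_mem _ (hpN hwp) (hW w hw))
  obtain ⟨i, hi⟩ : ∃ i, (decompose 𝒜 w i : R) ∉ p := by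
    by_contra! hall
    refine hwp ?_
    rw [← sum_support_decompose 𝒜 w]
    exact sum_mem fun i _ => hall i
  have hmap (x : R) (i : ℤ) := coe_decompose_map (ℬ := 𝒜) (𝒞 := hGr.overComponent S)
    (algebraMap R S) (fun i x hx => hGr.algebraMap_mem_fracComponent hx) x i
  have hcomp := coe_decompose_mul_add_of_left_mem (hGr.overComponent S) (a := ⟨y, hy⟩) (i := n)
    (j := i) (b := algebraMap R S w) hn
  rw [h, hmap, hmap] at hcomp
  exact (mem_homLocR_iff hGr).2 ⟨decompose 𝒜 r (n + i), decompose 𝒜 w i,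
    ⟨SetLike.isHomogeneousElem_coe _, hi⟩, (congrArg Subtype.val hcomp).symm⟩

end HomogeneousLocalization

section PerinormalImplies

variable {R : Type*} [CommRing R] [IsDomain R] {𝒜 : ℤ → AddSubgroup R}

theorem exists_valuationSubring_dominating (p : Ideal R) [p.IsPrime] :
    ∃ W : ValuationSubring (FractionRing R), ∀ r : R, algebraMap R (FractionRing R) r ∈ W ∧
      (r ∈ p ↔ W.valuation (algebraMap R (FractionRing R) r) < 1) := by
  have hunit (y : p.primeCompl) : IsUnit (algebraMap R (FractionRing R) y) :=
    (algebraMap_fractionRing_ne_zero (ne_zero_of_notMem y.2)).isUnit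
  let f : Localization.AtPrime p →+* FractionRing R := IsLocalization.lift hunit
  have hf (r : R) : f (algebraMap R _ r) = algebraMap R (FractionRing R) r :=
    IsLocalization.lift_eq hunit r
  obtain ⟨W, hW, hloc⟩ := IsLocalRing.exists_factor_valuationRing f
  refine ⟨W, fun r => ⟨hf r ▸ hW (algebraMap R _ r), ?_⟩⟩
  have hr : (⟨f (algebraMap R _ r), hW _⟩ : W) ∈ IsLocalRing.maximalIdeal W ↔ r ∈ p := by
    rw [← IsLocalization.AtPrime.to_map_mem_maximal_iff (Localization.AtPrime p) p r,
      IsLocalRing.mem_maximalIdeal, IsLocalRing.mem_maximalIdeal, mem_nonunits_iff,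
      mem_nonunits_iff, not_iff_not]
    exact isUnit_map_iff (f.codRestrict W.toSubring hW) _
  rw [← hr, W.valuation_lt_one_iff, ← hf]

theorem GradedPerinormal.grR1 (hGr : IsGrRing 𝒜) (h : GradedPerinormal 𝒜) : GrR1 𝒜 := by
  intro p hp hph
  have := hp.1
  obtain ⟨W, hW⟩ := exists_valuationSubring_dominating p
  let V : Subalgebra R (FractionRing R) :=
    Algebra.adjoin R {x : FractionRing R | x ∈ W ∧ IsHomFrac 𝒜 x}
  have hV : IsGradedOverring 𝒜 V := isGradedOverring_adjoin_of_isHomFrac hGr fun x hx => hx.2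
  have hVW (x : V) : (x : FractionRing R) ∈ W := by
    refine Algebra.adjoin_induction (hx := x.2) (p := fun y _ => y ∈ W) (fun y hy => hy.1)
      (fun r => (hW r).1) (fun y z _ _ => W.add_mem y z) (fun y z _ _ => W.mul_mem y z)
  let N₀ : Ideal V :=
    (IsLocalRing.maximalIdeal W).comap ((V.val : V →+* FractionRing R).codRestrict W hVW)
  have hN₀ (x : V) : x ∈ N₀ ↔ W.valuation (x : FractionRing R) < 1 := W.valuation_lt_one_iff _
  obtain ⟨N, hN, hNh, hNle, hNmem⟩ := hV.exists_core hGr (Q := N₀) inferInstance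
  have hunit (x : V) (hx : IsHomFrac 𝒜 (x : FractionRing R)) (hxN : x ∉ N) : IsUnit x := by
    have hx0 : (x : FractionRing R) ≠ 0 := fun h0 => hxN (by
      rw [Subtype.ext (a1 := x) (a2 := 0) h0]; exact N.zero_mem)
    have hval : W.valuation (x : FractionRing R) = 1 :=
      (W.valuation_lt_one_or_eq_one ⟨x, hVW x⟩).resolve_left fun hlt =>
        hxN (hNmem x ((hN₀ x).2 hlt) hx)
    have hinv : (x : FractionRing R)⁻¹ ∈ V := Algebra.subset_adjoin
      ⟨W.mem_of_valuation_le_one _ (by rw [map_inv₀, hval, inv_one]), hx.inv hx0⟩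
    exact IsUnit.of_mul_eq_one ⟨_, hinv⟩ (Subtype.ext (mul_inv_cancel₀ hx0))
  have hmax (J : Ideal V) (hJ : IsHomIdealOver 𝒜 V J) (hJt : J ≠ ⊤) : J ≤ N :=
    hJ.le_of_forall fun x hx hxh => by
      by_contra hxN
      exact hJt (Ideal.eq_top_of_isUnit_mem _ hx (hunit x hxh hxN))
  have hNp : N.comap (algebraMap R V) ≤ p := fun r hr => (hW r).2.2 ((hN₀ _).1 (hNle hr))
  have hpN : p ≤ N.comap (algebraMap R V) := hph.le_of_forall fun r hr hrh =>
    hNmem (algebraMap R V r) ((hN₀ _).2 ((hW r).2.1 hr)) (hGr.isHomFrac_algebraMap hrh)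
  have hGGD : GGD 𝒜 V := by
    intro P Q Qt hP hQ hQt hPh hQh hQth hPQ hcomap
    have hQp : Q ≤ p := by
      rw [← hcomap]
      exact (Ideal.comap_mono (hmax Qt hQth hQt.ne_top)).trans hNp
    rcases (hPQ.trans hQp).eq_or_lt with rfl | hlt
    · exact ⟨Qt, hQt, hQth, le_rfl, hcomap.trans (le_antisymm hQp hPQ)⟩
    · refine ⟨⊥, Ideal.isPrime_bot, isHomIdealOver_bot, bot_le, ?_⟩
      rw [hp.2.2 P hP hlt]
      exact Ideal.comap_bot_of_injective _ fun a b hab =>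
        IsFractionRing.injective R (FractionRing R) (congrArg Subtype.val hab)
  have hle : V ≤ HomLocR 𝒜 p := (h V hV (grLocalOver_of_forall_le hNh hN.ne_top hmax)
    hGGD).le_homLocR hGr hV hN.ne_top hpN
  intro x hx0 hx
  exact (W.mem_or_inv_mem x).imp (fun h => hle (Algebra.subset_adjoin ⟨h, hx⟩))
    fun h => hle (Algebra.subset_adjoin ⟨h, hx.inv hx0⟩)

theorem comap_algebraMap_homLocR_le (hGr : IsGrRing 𝒜) {p : Ideal R} [p.IsPrime]
    {Q : Ideal (HomLocR 𝒜 p)} (hQh : IsHomIdealOver 𝒜 (HomLocR 𝒜 p) Q) (hQ : Q ≠ ⊤) :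
    Q.comap (algebraMap R (HomLocR 𝒜 p)) ≤ p := by
  have := isLocalization_homLocR hGr p
  refine (hQh.comap_algebraMap hGr (isGradedOverring_homLocR hGr p)).le_of_forall
    fun x hx hxh => ?_
  by_contra hxp
  exact hQ (Ideal.eq_top_of_isUnit_mem _ hx
    (IsLocalization.map_units _ (⟨x, hxh, hxp⟩ : hGr.homCompl p)))

theorem exists_comap_algebraMap_homLocR_eq (hGr : IsGrRing 𝒜) {p P : Ideal R} [p.IsPrime]
    (hP : P.IsPrime) (hPh : IsHomIdeal 𝒜 P) (hPp : P ≤ p) :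
    ∃ Q : Ideal (HomLocR 𝒜 p), Q.IsPrime ∧ IsHomIdealOver 𝒜 (HomLocR 𝒜 p) Q ∧
      Q.comap (algebraMap R (HomLocR 𝒜 p)) = P := by
  have := isLocalization_homLocR hGr p
  have hdisj : Disjoint (hGr.homCompl p : Set R) P :=
    Set.disjoint_left.2 fun x hx hxP => hx.2 (hPp hxP)
  obtain ⟨C, hC, hCh, hCle, hCmem⟩ := (isGradedOverring_homLocR hGr p).exists_core hGr
    (IsLocalization.isPrime_of_isPrime_disjoint _ (HomLocR 𝒜 p) P hP hdisj)
  refine ⟨C, hC, hCh, le_antisymm ?_ (hPh.le_of_forall fun x hx hxh =>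
    hCmem _ (Ideal.mem_map_of_mem _ hx) (hGr.isHomFrac_algebraMap hxh))⟩
  exact (Ideal.comap_mono hCle).trans
    (IsLocalization.under_map_of_isPrime_disjoint _ (HomLocR 𝒜 p) hP hdisj).le

theorem le_of_comap_algebraMap_homLocR_le (hGr : IsGrRing 𝒜) {p : Ideal R} [p.IsPrime]
    {I J : Ideal (HomLocR 𝒜 p)}
    (h : I.comap (algebraMap R (HomLocR 𝒜 p)) ≤ J.comap (algebraMap R (HomLocR 𝒜 p))) :
    I ≤ J := by
  have := isLocalization_homLocR hGr p
  rw [← IsLocalization.map_under (hGr.homCompl p) (HomLocR 𝒜 p) I]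
  exact Ideal.map_le_iff_le_comap.2 h

theorem GradedPerinormal.eq_homLocR (hGr : IsGrRing 𝒜) (h : GradedPerinormal 𝒜) {p : Ideal R}
    [hp : p.IsPrime] (hph : IsHomIdeal 𝒜 p) {S : Subalgebra R (FractionRing R)}
    (hS : IsGradedOverring 𝒜 S) (hTS : HomLocR 𝒜 p ≤ S)
    (hbij : HSpecOrderReflBij 𝒜 (HomLocR 𝒜 p) S hTS) : S = HomLocR 𝒜 p := by
  obtain ⟨hcomap, -, hsurj, hrefl⟩ := hbij
  have hlep (Q : Ideal S) (hQ : Q.IsPrime) (hQh : IsHomIdealOver 𝒜 S Q) :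
      Q.comap (algebraMap R S) ≤ p := by
    rw [← comap_inclusion_comap_algebraMap hTS]
    exact comap_algebraMap_homLocR_le hGr (hcomap Q hQ hQh).2
      (hcomap Q hQ hQh).1.ne_top
  have hle (Q₁ Q₂ : Ideal S) (hQ₁ : Q₁.IsPrime) (hQ₁h : IsHomIdealOver 𝒜 S Q₁) (hQ₂ : Q₂.IsPrime)
      (hQ₂h : IsHomIdealOver 𝒜 S Q₂)
      (h : Q₁.comap (algebraMap R S) ≤ Q₂.comap (algebraMap R S)) : Q₁ ≤ Q₂ := by
    rw [← comap_inclusion_comap_algebraMap hTS, ← comap_inclusion_comap_algebraMap hTS] at h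
    exact hrefl Q₁ Q₂ hQ₁ hQ₁h hQ₂ hQ₂h (le_of_comap_algebraMap_homLocR_le hGr h)
  have hover (P : Ideal R) (hP : P.IsPrime) (hPh : IsHomIdeal 𝒜 P) (hPp : P ≤ p) :
      ∃ Q : Ideal S, Q.IsPrime ∧ IsHomIdealOver 𝒜 S Q ∧ Q.comap (algebraMap R S) = P := by
    obtain ⟨P', hP', hP'h, rfl⟩ := exists_comap_algebraMap_homLocR_eq hGr hP hPh hPp
    obtain ⟨Q, hQ, hQh, rfl⟩ := hsurj P' hP' hP'h
    exact ⟨Q, hQ, hQh, (comap_inclusion_comap_algebraMap hTS Q).symm⟩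
  obtain ⟨N, hN, hNh, hNp⟩ := hover p hp hph le_rfl
  have hmax (J : Ideal S) (hJ : IsHomIdealOver 𝒜 S J) (hJt : J ≠ ⊤) : J ≤ N := by
    obtain ⟨M, hJM, hM⟩ := hS.exists_le_isGrMaxIdealOver hGr hJ hJt
    have hMp := hM.isPrime hGr hS
    exact hJM.trans (hle M N hMp hM.1 hN hNh (hNp ▸ hlep M hMp hM.1))
  have hGGD : GGD 𝒜 S := by
    rintro P _ Qt hP hQ hQt hPh hQh hQth hPQ rfl
    obtain ⟨Pt, hPt, hPth, rfl⟩ := hover P hP hPh (hPQ.trans (hlep Qt hQt hQth))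
    exact ⟨Pt, hPt, hPth, hle Pt Qt hPt hPth hQt hQth hPQ, rfl⟩
  exact le_antisymm ((h S hS (grLocalOver_of_forall_le hNh hN.ne_top hmax) hGGD).le_homLocR hGr hS
    hN.ne_top hNp.ge) hTS

end PerinormalImplies

section SimpleExtensions

open Polynomial

variable {R : Type*} [CommRing R] {𝒜 : ℤ → AddSubgroup R}

theorem aeval_adjoin_singleton_surjective (y : FractionRing R) : Function.Surjective
    (aeval (⟨y, Algebra.self_mem_adjoin_singleton R y⟩ : Algebra.adjoin R {y}) :
      R[X] →ₐ[R] Algebra.adjoin R {y}) := by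
  rintro ⟨a, ha⟩
  obtain ⟨f, hf⟩ := (Algebra.adjoin_singleton_eq_range_aeval R y).le ha
  exact ⟨f, Subtype.ext ((aeval_subalgebra_coe f _ _).trans hf)⟩

variable [IsDomain R]

/-- The contraction to `R` of a minimal prime of a homogeneous element `y` of a simple graded
extension `R[y]` of a gr-(R₁) domain has height one, so `y` lies in its homogeneous
localization. -/
theorem GrR1.exists_of_mem_minimalPrimes [IsNoetherianRing R] (hGr : IsGrRing 𝒜)
    (hcat : IsUnivCatenary R) (hR1 : GrR1 𝒜) {y : FractionRing R} (hy0 : y ≠ 0)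
    (hy : IsHomFrac 𝒜 y) {Q : Ideal (Algebra.adjoin R {y})}
    (hQ : Q ∈ (Ideal.span {(⟨y, Algebra.self_mem_adjoin_singleton R y⟩ :
      Algebra.adjoin R {y})}).minimalPrimes) :
    (Q.comap (algebraMap R (Algebra.adjoin R {y}))).IsPrime ∧
    IsHomIdeal 𝒜 (Q.comap (algebraMap R (Algebra.adjoin R {y}))) ∧
    ∃ c ∈ Q.comap (algebraMap R (Algebra.adjoin R {y})),
      ∃ w ∉ Q.comap (algebraMap R (Algebra.adjoin R {y})),
        y * algebraMap R (FractionRing R) w = algebraMap R (FractionRing R) c := by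
  have hA : IsGradedOverring 𝒜 (Algebra.adjoin R {y}) :=
    isGradedOverring_adjoin_of_isHomFrac hGr fun x hx => Set.mem_singleton_iff.1 hx ▸ hy
  have hhom : IsHomIdeal 𝒜 (Q.comap (algebraMap R (Algebra.adjoin R {y}))) :=
    (hA.isHomIdealOver_of_mem_minimalPrimes hGr hy hQ).comap_algebraMap hGr hA
  have hyQ : (⟨y, Algebra.self_mem_adjoin_singleton R y⟩ : Algebra.adjoin R {y}) ∈ Q :=
    hQ.1.2 (Ideal.mem_span_singleton_self _)
  have hheight : HeightOnePrime (Q.comap (algebraMap R (Algebra.adjoin R {y}))) := by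
    obtain ⟨i, j, a, b, -, -, hb0, hab⟩ := hy
    let φ : R[X] →ₐ[R] Algebra.adjoin R {y} := aeval ⟨y, Algebra.self_mem_adjoin_singleton R y⟩
    have hφX : φ X = ⟨y, Algebra.self_mem_adjoin_singleton R y⟩ := aeval_X _
    have hφC (r : R) : φ (C r) = algebraMap R (Algebra.adjoin R {y}) r := aeval_C _ _
    have hφ : (φ : R[X] →+* Algebra.adjoin R {y}).comp C =
        algebraMap R (Algebra.adjoin R {y}) := RingHom.ext hφC
    have hsurj : Function.Surjective (φ : R[X] →+* Algebra.adjoin R {y}) :=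
      aeval_adjoin_singleton_surjective y
    have := isNoetherianRing_of_surjective _ _ _ hsurj
    rw [← hφ]
    refine heightOnePrime_comap_of_mem_minimalPrimes hcat.isCatenaryRing_polynomial
      (φ : R[X] →+* Algebra.adjoin R {y}) hsurj ?_ (a := a) hb0 ?_ ?_ ?_
    · rw [hφ]
      exact fun c d hcd => IsFractionRing.injective R (FractionRing R) (congrArg Subtype.val hcd)
    · change φ (C b) * φ X = φ (C a)
      rw [hφX, hφC, hφC]
      exact Subtype.ext ((mul_comm _ _).trans hab)
    · change φ X ≠ 0
      rw [hφX]
      exact fun h => hy0 (congrArg Subtype.val h)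
    · change Q ∈ (Ideal.span {φ X}).minimalPrimes
      rwa [hφX]
  have hq := hheight.1
  refine ⟨hq, hhom, ?_⟩
  rcases hR1 _ hheight hhom y hy0 hy with h | h
  · obtain ⟨c, w, hw, h⟩ := (mem_homLocR_iff hGr).1 h
    refine ⟨c, ?_, w, hw.2, h⟩
    have hc : algebraMap R (Algebra.adjoin R {y}) c =
        ⟨y, Algebra.self_mem_adjoin_singleton R y⟩ * algebraMap R _ w := Subtype.ext h.symm
    rw [Ideal.mem_comap, hc]
    exact Q.mul_mem_right _ hyQ
  · obtain ⟨c, w, hw, h⟩ := (mem_homLocR_iff hGr).1 h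
    refine absurd ?_ hw.2
    have hwc : algebraMap R (Algebra.adjoin R {y}) w =
        ⟨y, Algebra.self_mem_adjoin_singleton R y⟩ * algebraMap R _ c :=
      Subtype.ext ((eq_inv_mul_iff_mul_eq₀ (inv_ne_zero hy0)).2 h |>.trans (by rw [inv_inv]; rfl))
    rw [Ideal.mem_comap, hwc]
    exact Q.mul_mem_right _ hyQ

theorem isIntegral_inv_of_mem_span (hGr : IsGrRing 𝒜) {p : Ideal R} [p.IsPrime]
    {y : FractionRing R} (hy0 : y ≠ 0) {u : R} (hu : u ∈ hGr.homCompl p)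
    (huy : algebraMap R (Algebra.adjoin R {y}) u ∈
      Ideal.span {(⟨y, Algebra.self_mem_adjoin_singleton R y⟩ : Algebra.adjoin R {y})}) :
    IsIntegral (HomLocR 𝒜 p) y⁻¹ := by
  obtain ⟨g, hg⟩ := Ideal.mem_span_singleton'.1 huy
  obtain ⟨f, rfl⟩ := aeval_adjoin_singleton_surjective y g
  have hg' : aeval y f * y = algebraMap R (FractionRing R) u := by
    rw [← aeval_subalgebra_coe f _ ⟨y, Algebra.self_mem_adjoin_singleton R y⟩]
    exact congrArg Subtype.val hg
  have hu0 := algebraMap_fractionRing_ne_zero (ne_zero_of_notMem hu.2)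
  let v : HomLocR 𝒜 p := ⟨(algebraMap R (FractionRing R) u)⁻¹, (mem_homLocR_iff hGr).2
    ⟨1, u, hu, by rw [map_one, inv_mul_cancel₀ hu0]⟩⟩
  let P : (HomLocR 𝒜 p)[X] := 1 - X * (C v * f.map (algebraMap R (HomLocR 𝒜 p)))
  have hP0 : P.coeff 0 = 1 := by simp [P]
  have hPy : eval₂ (algebraMap (HomLocR 𝒜 p) (FractionRing R)) y P = 0 := by
    have hfy : eval₂ (algebraMap (HomLocR 𝒜 p) (FractionRing R)) y
        (f.map (algebraMap R (HomLocR 𝒜 p))) = aeval y f := by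
      rw [eval₂_map, ← IsScalarTower.algebraMap_eq, aeval_def]
    have hv : algebraMap (HomLocR 𝒜 p) (FractionRing R) v =
      (algebraMap R (FractionRing R) u)⁻¹ := rfl
    rw [eval₂_sub, eval₂_one, eval₂_mul, eval₂_X, eval₂_mul, eval₂_C, hfy, hv, sub_eq_zero,
      mul_left_comm, mul_comm y, hg', inv_mul_cancel₀ hu0]
  refine ⟨P.reverse, ?_, ?_⟩
  · rw [Monic, reverse_leadingCoeff, trailingCoeff,
      natTrailingDegree_eq_zero.2 (Or.inr (by rw [hP0]; exact one_ne_zero)), hP0]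
  · let := invertibleOfNonzero hy0
    rw [← invOf_eq_inv]
    exact (eval₂_reverse_eq_zero_iff _ _ _).2 hPy

end SimpleExtensions

section ImpliesPerinormal

variable {R : Type*} [CommRing R] [IsDomain R] {𝒜 : ℤ → AddSubgroup R}
  {S : Subalgebra R (FractionRing R)} {N : Ideal S}

theorem homLocR_comap_le (hGr : IsGrRing 𝒜) (hS : IsGradedOverring 𝒜 S)
    (hloc : GrLocalOver 𝒜 S) (hN : IsGrMaxIdealOver 𝒜 S N) :
    HomLocR 𝒜 (N.comap (algebraMap R S)) ≤ S := by
  refine Algebra.adjoin_le ?_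
  rintro x ⟨a, w, hw, hwN, h⟩
  obtain ⟨v, hv⟩ := (isUnit_of_notMem_isGrMaxIdealOver hGr hS hloc hN
    (hGr.isHomFrac_algebraMap hw : IsHomFrac 𝒜 (algebraMap R S w : FractionRing R))
      hwN).exists_right_inv
  have hv' : algebraMap R (FractionRing R) w * v = 1 := congrArg Subtype.val hv
  have hx : x = algebraMap R (FractionRing R) a * v := by rw [← h, mul_assoc, hv', mul_one]
  rw [hx]
  exact mul_mem (Subalgebra.algebraMap_mem _ _) v.2

theorem isIntegral_homLocR_comap [IsNoetherianRing R] (hGr : IsGrRing 𝒜)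
    (hcat : IsUnivCatenary R) (hR1 : GrR1 𝒜) (hS : IsGradedOverring 𝒜 S)
    (hGGD : GGD 𝒜 S) (hN : N.IsPrime) (hNh : IsHomIdealOver 𝒜 S N)
    {x : FractionRing R} (hxS : x ∈ S) (hx : IsHomFrac 𝒜 x) :
    IsIntegral (HomLocR 𝒜 (N.comap (algebraMap R S))) x := by
  by_cases hx0 : x = 0
  · rw [hx0]; exact isIntegral_zero
  have hy0 : x⁻¹ ≠ 0 := inv_ne_zero hx0
  have : (N.comap (algebraMap R S)).IsPrime := inferInstance
  by_cases hdisj : Disjoint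
      (Ideal.span {(⟨x⁻¹, Algebra.self_mem_adjoin_singleton R x⁻¹⟩ :
        Algebra.adjoin R {x⁻¹})} : Set (Algebra.adjoin R {x⁻¹}))
      ((hGr.homCompl (N.comap (algebraMap R S))).map (algebraMap R (Algebra.adjoin R {x⁻¹})) :
        Set (Algebra.adjoin R {x⁻¹}))
  · obtain ⟨Q', hQ', hle, hQ'disj⟩ := Ideal.exists_le_prime_disjoint _ _ hdisj
    obtain ⟨Q, hQ, hQle⟩ := Ideal.exists_minimalPrimes_le hle
    obtain ⟨hq, hqh, c, hc, w, hw, h⟩ :=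
      hR1.exists_of_mem_minimalPrimes hGr hcat hy0 (hx.inv hx0) hQ
    have hqN : Q.comap (algebraMap R (Algebra.adjoin R {x⁻¹})) ≤ N.comap (algebraMap R S) :=
      hqh.le_of_forall fun r hr hrh => by
        by_contra hrN
        exact Set.disjoint_left.1 hQ'disj (hQle hr) ⟨r, ⟨hrh, hrN⟩, rfl⟩
    obtain ⟨P, -, -, -, hP⟩ := hGGD _ _ N hq inferInstance hN hqh (hNh.comap_algebraMap hGr hS)
      hNh hqN rfl
    refine absurd ?_ hw
    rw [← hP] at hc ⊢
    have hwx : algebraMap R S w = ⟨x, hxS⟩ * algebraMap R S c :=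
      Subtype.ext ((inv_mul_eq_iff_eq_mul₀ hx0).1 h)
    rw [Ideal.mem_comap, hwx]
    exact P.mul_mem_left _ hc
  · obtain ⟨_, huy, u, hu, rfl⟩ := Set.not_disjoint_iff.1 hdisj
    rw [← inv_inv x]
    exact isIntegral_inv_of_mem_span hGr hy0 hu huy

/-- Under gr-(R₁) and graded going-down, contraction of homogeneous primes reflects the order. -/
theorem le_of_comap_algebraMap_le [IsNoetherianRing R] (hGr : IsGrRing 𝒜)
    (hcat : IsUnivCatenary R) (hR1 : GrR1 𝒜) (hS : IsGradedOverring 𝒜 S)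
    (hGGD : GGD 𝒜 S) {Q₁ Q₂ : Ideal S} (hQ₁ : Q₁.IsPrime) (hQ₁h : IsHomIdealOver 𝒜 S Q₁)
    (hQ₂ : Q₂.IsPrime) (hQ₂h : IsHomIdealOver 𝒜 S Q₂)
    (h : Q₁.comap (algebraMap R S) ≤ Q₂.comap (algebraMap R S)) : Q₁ ≤ Q₂ := by
  refine hQ₁h.le_of_forall fun x hx hxh => ?_
  by_cases hx0 : (x : FractionRing R) = 0
  · rw [Subtype.ext (a1 := x) (a2 := 0) hx0]
    exact Q₂.zero_mem
  have hAS : Algebra.adjoin R {(x : FractionRing R)} ≤ S :=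
    Algebra.adjoin_le (Set.singleton_subset_iff.2 x.2)
  obtain ⟨Q, hQ, hQle⟩ := Ideal.exists_minimalPrimes_le
    (J := Q₁.comap (Subalgebra.inclusion hAS))
    ((Ideal.span_singleton_le_iff_mem (x := ⟨x, Algebra.self_mem_adjoin_singleton R _⟩) _).2 hx)
  obtain ⟨hq, hqh, c, hc, w, hw, hwc⟩ := hR1.exists_of_mem_minimalPrimes hGr hcat hx0 hxh hQ
  have hqQ₁ := Ideal.comap_mono (f := algebraMap R (Algebra.adjoin R {(x : FractionRing R)})) hQle
  rw [comap_inclusion_comap_algebraMap] at hqQ₁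
  obtain ⟨P, hP, -, hPle, hPq⟩ := hGGD _ _ Q₂ hq inferInstance hQ₂ hqh
    (hQ₂h.comap_algebraMap hGr hS) hQ₂h (hqQ₁.trans h) rfl
  rw [← hPq] at hc hw
  have hxw : x * algebraMap R S w = algebraMap R S c := Subtype.ext hwc
  exact hPle ((hP.mem_or_mem (hxw ▸ hc : x * algebraMap R S w ∈ P)).resolve_right hw)

theorem hSpecOrderReflBij_homLocR_comap [IsNoetherianRing R] (hGr : IsGrRing 𝒜)
    (hcat : IsUnivCatenary R) (hR1 : GrR1 𝒜) (hS : IsGradedOverring 𝒜 S)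
    (hGGD : GGD 𝒜 S) (hN : N.IsPrime) (hNh : IsHomIdealOver 𝒜 S N)
    (hTS : HomLocR 𝒜 (N.comap (algebraMap R S)) ≤ S) :
    HSpecOrderReflBij 𝒜 (HomLocR 𝒜 (N.comap (algebraMap R S))) S hTS := by
  have hT := isGradedOverring_homLocR hGr (N.comap (algebraMap R S))
  have hNp : (N.comap (algebraMap R S)).IsPrime := inferInstance
  have hrefl (Q₁ Q₂ : Ideal S) (hQ₁ : Q₁.IsPrime) (hQ₁h : IsHomIdealOver 𝒜 S Q₁)
      (hQ₂ : Q₂.IsPrime) (hQ₂h : IsHomIdealOver 𝒜 S Q₂)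
      (h : Q₁.comap (Subalgebra.inclusion hTS) ≤ Q₂.comap (Subalgebra.inclusion hTS)) :
      Q₁ ≤ Q₂ := by
    have h' := Ideal.comap_mono
      (f := algebraMap R (HomLocR 𝒜 (N.comap (algebraMap R S)))) h
    rw [comap_inclusion_comap_algebraMap, comap_inclusion_comap_algebraMap] at h'
    exact le_of_comap_algebraMap_le hGr hcat hR1 hS hGGD hQ₁ hQ₁h hQ₂ hQ₂h h'
  refine ⟨fun Q hQ hQh => ⟨hQ.comap _, hQh.comap_inclusion hGr hS hT hTS⟩,
    fun Q₁ Q₂ hQ₁ hQ₁h hQ₂ hQ₂h h => le_antisymm (hrefl Q₁ Q₂ hQ₁ hQ₁h hQ₂ hQ₂h h.le)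
      (hrefl Q₂ Q₁ hQ₂ hQ₂h hQ₁ hQ₁h h.ge), fun P hP hPh => ?_, hrefl⟩
  obtain ⟨Q, hQ, hQh, -, hQP⟩ := hGGD _ _ N (hP.comap _) hNp hN (hPh.comap_algebraMap hGr hT)
    (hNh.comap_algebraMap hGr hS) hNh (comap_algebraMap_homLocR_le hGr hPh hP.ne_top) rfl
  rw [← comap_inclusion_comap_algebraMap hTS] at hQP
  exact ⟨Q, hQ, hQh, le_antisymm (le_of_comap_algebraMap_homLocR_le hGr hQP.le)
    (le_of_comap_algebraMap_homLocR_le hGr hQP.ge)⟩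

theorem gradedPerinormal_of_grR1 [IsNoetherianRing R] (hGr : IsGrRing 𝒜)
    (hcat : IsUnivCatenary R) (hR1 : GrR1 𝒜)
    (huniq : ∀ 𝔭 : Ideal R, 𝔭.IsPrime → IsHomIdeal 𝒜 𝔭 →
      ∀ S : Subalgebra R (FractionRing R), HomLocR 𝒜 𝔭 ≤ S →
        (S : Set (FractionRing R)) ⊆
          (integralClosure (HomLocR 𝒜 𝔭) (FractionRing R) : Set (FractionRing R)) →
        IsGradedOverring 𝒜 S →
        ∀ hTS : HomLocR 𝒜 𝔭 ≤ S, HSpecOrderReflBij 𝒜 (HomLocR 𝒜 𝔭) S hTS →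
          S = HomLocR 𝒜 𝔭) : GradedPerinormal 𝒜 := by
  intro S hS hloc hGGD
  obtain ⟨N, hN, -⟩ := id hloc
  have hNp := hN.isPrime hGr hS
  have hTS := homLocR_comap_le hGr hS hloc hN
  have hintegral : (S : Set (FractionRing R)) ⊆
      (integralClosure (HomLocR 𝒜 (N.comap (algebraMap R S))) (FractionRing R) :
        Set (FractionRing R)) := fun x hx =>
    (AddSubmonoid.closure_le (S := (integralClosure (HomLocR 𝒜 (N.comap (algebraMap R S)))
      (FractionRing R)).toSubring.toAddSubgroup.toAddSubmonoid)).2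
      (fun y hy => isIntegral_homLocR_comap hGr hcat hR1 hS hGGD hNp hN.1 hy.1 hy.2) (hS x hx)
  rw [huniq _ inferInstance (hN.1.comap_algebraMap hGr hS) S hTS hintegral hS hTS
    (hSpecOrderReflBij_homLocR_comap hGr hcat hR1 hS hGGD hNp hN.1 hTS)]
  exact isLocalizationOfR_homLocR hGr _

end ImpliesPerinormal

/-- Let `R` be a `ℤ`-graded Noetherian universally catenary domain. The
following are equivalent: (a) `R` is a graded perinormal domain; (b) `R` is gr-(R₁) and for
each homogeneous prime `𝔭` of `R`, `R_(𝔭)` is the only graded ring between `R_(𝔭)` and the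
graded quotient field `R_H` whose homogeneous primes biject order-reflectingly with those of
`R_(𝔭)` under contraction; (c) `R` is gr-(R₁) and for each homogeneous prime `𝔭` of `R`,
`R_(𝔭)` is the only graded ring between `R_(𝔭)` and its integral closure with that property. -/
theorem gradedPerinormal_tfae_of_noetherian_univCatenary
    {R : Type*} [CommRing R] [IsDomain R] [IsNoetherianRing R]
    (𝒜 : ℤ → AddSubgroup R) (hGr : IsGrRing 𝒜)
    (hcat : IsUnivCatenary R) :
    (GradedPerinormal 𝒜 ↔
      (GrR1 𝒜 ∧ ∀ 𝔭 : Ideal R, 𝔭.IsPrime → IsHomIdeal 𝒜 𝔭 →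
        ∀ S : Subalgebra R (FractionRing R), HomLocR 𝒜 𝔭 ≤ S → S ≤ RHfull 𝒜 →
          IsGradedOverring 𝒜 S →
          ∀ hTS : HomLocR 𝒜 𝔭 ≤ S, HSpecOrderReflBij 𝒜 (HomLocR 𝒜 𝔭) S hTS →
            S = HomLocR 𝒜 𝔭)) ∧
    ((GrR1 𝒜 ∧ ∀ 𝔭 : Ideal R, 𝔭.IsPrime → IsHomIdeal 𝒜 𝔭 →
        ∀ S : Subalgebra R (FractionRing R), HomLocR 𝒜 𝔭 ≤ S → S ≤ RHfull 𝒜 →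
          IsGradedOverring 𝒜 S →
          ∀ hTS : HomLocR 𝒜 𝔭 ≤ S, HSpecOrderReflBij 𝒜 (HomLocR 𝒜 𝔭) S hTS →
            S = HomLocR 𝒜 𝔭) ↔
      (GrR1 𝒜 ∧ ∀ 𝔭 : Ideal R, 𝔭.IsPrime → IsHomIdeal 𝒜 𝔭 →
        ∀ S : Subalgebra R (FractionRing R), HomLocR 𝒜 𝔭 ≤ S →
          (S : Set (FractionRing R)) ⊆
            (integralClosure (HomLocR 𝒜 𝔭) (FractionRing R) : Set (FractionRing R)) →
          IsGradedOverring 𝒜 S →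
          ∀ hTS : HomLocR 𝒜 𝔭 ≤ S, HSpecOrderReflBij 𝒜 (HomLocR 𝒜 𝔭) S hTS →
            S = HomLocR 𝒜 𝔭)) := by
  have hab (h : GradedPerinormal 𝒜) : GrR1 𝒜 ∧ ∀ 𝔭 : Ideal R, 𝔭.IsPrime → IsHomIdeal 𝒜 𝔭 →
      ∀ S : Subalgebra R (FractionRing R), HomLocR 𝒜 𝔭 ≤ S → S ≤ RHfull 𝒜 →
        IsGradedOverring 𝒜 S →
        ∀ hTS : HomLocR 𝒜 𝔭 ≤ S, HSpecOrderReflBij 𝒜 (HomLocR 𝒜 𝔭) S hTS →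
          S = HomLocR 𝒜 𝔭 :=
    ⟨h.grR1 hGr, fun 𝔭 _ h𝔭 S _ _ hS hTS hbij => h.eq_homLocR hGr h𝔭 hS hTS hbij⟩
  refine ⟨⟨hab, fun h => ?_⟩, fun h => ⟨h.1, ?_⟩, fun h => ?_⟩
  · exact gradedPerinormal_of_grR1 hGr hcat h.1 fun 𝔭 h𝔭 h𝔭h S hle _ hS =>
      h.2 𝔭 h𝔭 h𝔭h S hle hS.le_RHfull hS
  · exact fun 𝔭 h𝔭 h𝔭h S hle _ hS => h.2 𝔭 h𝔭 h𝔭h S hle hS.le_RHfull hS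
  · exact hab (gradedPerinormal_of_grR1 hGr hcat h.1 h.2)
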